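/- arXiv:1804.03432 — 6 statements merged into one kernel-verified Lean document; each statement's English description precedes it below -/
import Mathlib

section
/- Let H be a complex separable Hilbert space and let A=(T_{kj})_{k,j≥1} and B=(S_{kj})_{k,j≥1} be matrices with entries in B(H), both of which belong to B(ℓ²(H)). Then their Schur product A*B=(T_{kj}∘S_{kj})_{k,j≥1} belongs to B(ℓ²(H)) and ‖A*B‖_{B(ℓ²(H))} ≤ ‖A‖_{B(ℓ²(H))}·‖B‖_{B(ℓ²(H))}. -/
open scoped ENNReal NNReal ComplexConjugate
open MeasureTheory

noncomputable section

variable {H : Type*} [NormedAddCommGroup H] [InnerProductSpace ℂ H] [CompleteSpace H]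

/-- `ℓ²(H)`: square-summable `H`-valued sequences. -/
abbrev ellTwo (H : Type*) [NormedAddCommGroup H] [InnerProductSpace ℂ H] : Type _ :=
  lp (fun _ : ℕ => H) 2

/-- A bounded operator `A` on `ℓ²(H)` *represents* the matrix `(T k j)_{k,j}` (with entries in
`B(H)`) if on each "basis vector" `x·e_j` it acts as the matrix does, i.e. the matrix belongs to
`B(ℓ²(H))` and `A` is the corresponding bounded extension. -/
def Represents (T : ℕ → ℕ → H →L[ℂ] H) (A : ellTwo H →L[ℂ] ellTwo H) : Prop :=
  ∀ (j : ℕ) (x : H) (k : ℕ), A (lp.single 2 j x) k = T k j x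

theorem ellTwo_sq {ι : Type*} (f : lp (fun _ : ι => H) 2) :
    HasSum (fun i => ‖f i‖ ^ 2) (‖f‖ ^ 2) := by
  have h := lp.hasSum_norm (p := 2) (by norm_num) f
  simpa using h

theorem exists_spread (A : ellTwo H →L[ℂ] ellTwo H) (e : ℕ × ℕ ≃ ℕ × ℕ) :
    ∃ V : ellTwo H →L[ℂ] lp (fun _ : ℕ × ℕ => H) 2,
      (∀ x p, V x p = A (lp.single 2 (e p).1 (x (e p).1)) (e p).2) ∧ ‖V‖ ≤ ‖A‖ := by
  have hb : ∀ (x : ellTwo H) (j : ℕ),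
      ‖A (lp.single 2 j (x j))‖ ^ 2 ≤ ‖A‖ ^ 2 * ‖x j‖ ^ 2 := by
    intro x j
    rw [← mul_pow]
    have := A.le_opNorm (lp.single 2 j (x j))
    rw [lp.norm_single (by norm_num)] at this
    gcongr
  have hs0 : ∀ x : ellTwo H, Summable (fun j => ‖A (lp.single 2 j (x j))‖ ^ 2) := fun x =>
    Summable.of_nonneg_of_le (fun _ => by positivity) (hb x) ((ellTwo_sq x).summable.mul_left _)
  have hs1 : ∀ x : ellTwo H,
      Summable (fun q : ℕ × ℕ => ‖A (lp.single 2 q.1 (x q.1)) q.2‖ ^ 2) := by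
    intro x
    rw [summable_prod_of_nonneg (fun _ => by positivity)]
    refine ⟨fun j => (ellTwo_sq (A (lp.single 2 j (x j)))).summable, ?_⟩
    simpa only [(ellTwo_sq (A (lp.single 2 _ (x _)))).tsum_eq] using hs0 x
  have hs2 : ∀ x : ellTwo H, Memℓp
      (fun p : ℕ × ℕ => A (lp.single 2 (e p).1 (x (e p).1)) (e p).2) 2 := by
    intro x
    apply memℓp_gen
    have := (e.summable_iff).2 (hs1 x)
    simpa [Function.comp_def] using this
  let L : ellTwo H →ₗ[ℂ] lp (fun _ : ℕ × ℕ => H) 2 :=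
    { toFun := fun x => ⟨_, hs2 x⟩
      map_add' := by
        intro x y
        ext p
        simp
        rfl
      map_smul' := by
        intro c x
        ext p
        simp }
  refine ⟨L.mkContinuous ‖A‖ ?_, fun x p => rfl, L.mkContinuous_norm_le (norm_nonneg _) _⟩
  intro x
  have h1 : ‖L x‖ ^ 2 = ∑' j, ‖A (lp.single 2 j (x j))‖ ^ 2 := by
    rw [← (ellTwo_sq (L x)).tsum_eq]
    have := e.tsum_eq (fun q : ℕ × ℕ => ‖A (lp.single 2 q.1 (x q.1)) q.2‖ ^ 2)
    refine this.trans ?_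
    rw [(hs1 x).tsum_prod' (fun j => (ellTwo_sq (A (lp.single 2 j (x j)))).summable)]
    exact tsum_congr fun j => (ellTwo_sq (A (lp.single 2 j (x j)))).tsum_eq
  have h2 : ‖L x‖ ^ 2 ≤ (‖A‖ * ‖x‖) ^ 2 := by
    rw [h1, mul_pow, ← (ellTwo_sq x).tsum_eq, ← tsum_mul_left]
    exact (hs0 x).tsum_le_tsum (hb x) ((ellTwo_sq x).summable.mul_left _)
  exact le_of_sq_le_sq h2 (by positivity)

theorem schur_product_bounded
    (T S : ℕ → ℕ → H →L[ℂ] H) (A B : ellTwo H →L[ℂ] ellTwo H)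
    (hA : Represents T A) (hB : Represents S B) :
    ∃ C : ellTwo H →L[ℂ] ellTwo H,
      Represents (fun k j => (T k j).comp (S k j)) C ∧ ‖C‖ ≤ ‖A‖ * ‖B‖ := by
  obtain ⟨V, hV, hVn⟩ := exists_spread B (Equiv.prodComm ℕ ℕ)
  obtain ⟨W, hW, hWn⟩ := exists_spread (ContinuousLinearMap.adjoint A) (Equiv.refl _)
  refine ⟨(ContinuousLinearMap.adjoint W).comp V, ?_, ?_⟩
  · intro j x k
    refine ext_inner_left ℂ fun (z : H) => ?_
    have h1 : inner ℂ (A.adjoint (lp.single 2 k z) j) (S k j x) = inner ℂ z (T k j (S k j x)) := by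
      refine (lp.inner_single_right (𝕜 := ℂ) (G := fun _ : ℕ => H) j (S k j x)
        (A.adjoint (lp.single 2 k z))).symm.trans ?_
      rw [ContinuousLinearMap.adjoint_inner_left]
      refine (lp.inner_single_left (𝕜 := ℂ) (G := fun _ : ℕ => H) k z _).trans ?_
      exact congrArg (inner ℂ z) (hA j (S k j x) k)
    refine (lp.inner_single_left (𝕜 := ℂ) (G := fun _ : ℕ => H) k z
      (((ContinuousLinearMap.adjoint W).comp V) (lp.single 2 j x))).symm.trans ?_
    rw [ContinuousLinearMap.comp_apply,
      ContinuousLinearMap.adjoint_inner_right, lp.inner_eq_tsum, tsum_eq_single (k, j)]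
    · rw [hV, hW]
      simp only [Equiv.prodComm_apply, Prod.swap, Equiv.refl_apply, lp.single_apply_self]
      rw [hB]
      exact h1
    · rintro ⟨k', j'⟩ hne
      rw [hV, hW]
      simp only [Equiv.prodComm_apply, Prod.swap, Equiv.refl_apply]
      by_cases hj : j' = j
      · have hk : k' ≠ k := fun h => hne (by rw [h, hj])
        rw [lp.single_apply_ne (E := fun _ : ℕ => H) 2 k z hk]
        simp
      · rw [lp.single_apply_ne (E := fun _ : ℕ => H) 2 j x hj]
        simp
  · refine (ContinuousLinearMap.opNorm_comp_le _ _).trans ?_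
    rw [LinearIsometryEquiv.norm_map] at hWn ⊢
    gcongr

end
end

section
/- Let H be a complex separable Hilbert space and let A=(T_{kj})_{k,j≥1} be a matrix with entries in B(H). For j ≥ 1 let C_j=(T_{kj})_{k≥1} and for k ≥ 1 let R_k^*=(T_{kj}^*)_{j≥1}. If M := min{ (Σ_{j≥1} ‖C_j‖²_{ℓ²_SOT})^{1/2}, (Σ_{k≥1} ‖R_k^*‖²_{ℓ²_SOT})^{1/2} } < ∞, then A belongs to B(ℓ²(H)) and ‖A‖_{B(ℓ²(H))} ≤ M. -/
open scoped ENNReal NNReal ComplexConjugate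
open MeasureTheory

noncomputable section

variable {H : Type*} [NormedAddCommGroup H] [InnerProductSpace ℂ H] [CompleteSpace H]

/-- The `ℓ²_SOT` norm (squared, in `ℝ≥0∞`) of a sequence of operators:
`sup_{‖x‖=1} Σ_n ‖T_n x‖²`. -/
def sotNormSq (T : ℕ → H →L[ℂ] H) : ℝ≥0∞ :=
  ⨆ x : {x : H // ‖x‖ = 1}, ∑' n : ℕ, (‖T n (x : H)‖₊ : ℝ≥0∞) ^ 2

theorem tsum_le_sotNormSq (T : ℕ → H →L[ℂ] H) (x : H) :
    ∑' n : ℕ, (‖T n x‖₊ : ℝ≥0∞) ^ 2 ≤ sotNormSq T * (‖x‖₊ : ℝ≥0∞) ^ 2 := by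
  by_cases hx : x = 0
  · simp [hx]
  have hx' : ‖x‖ ≠ 0 := norm_ne_zero_iff.mpr hx
  have hu : ‖((‖x‖⁻¹ : ℝ) : ℂ) • x‖ = 1 := by
    rw [norm_smul]; simp [hx']
  have h1 : ∑' n : ℕ, (‖T n (((‖x‖⁻¹ : ℝ) : ℂ) • x)‖₊ : ℝ≥0∞) ^ 2 ≤ sotNormSq T :=
    le_iSup (fun x : {x : H // ‖x‖ = 1} => ∑' n : ℕ, (‖T n (x : H)‖₊ : ℝ≥0∞) ^ 2) ⟨_, hu⟩
  refine le_trans (le_of_eq ?_) (mul_le_mul_left h1 _)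
  rw [← ENNReal.tsum_mul_right]
  congr 1
  ext1 n
  have : ‖T n x‖₊ = ‖T n (((‖x‖⁻¹ : ℝ) : ℂ) • x)‖₊ * ‖x‖₊ := by
    apply NNReal.eq
    simp only [map_smul, NNReal.coe_mul, coe_nnnorm, norm_smul]
    simp
    field_simp
  rw [this, ENNReal.coe_mul, mul_pow]

theorem hasSum_sot (T : ℕ → H →L[ℂ] H) (hT : sotNormSq T ≠ ⊤) (x : H) :
    Summable (fun n => ‖T n x‖ ^ 2) ∧
      ∑' n, ‖T n x‖ ^ 2 ≤ (sotNormSq T).toReal * ‖x‖ ^ 2 := by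
  have h := tsum_le_sotNormSq T x
  have hfin : sotNormSq T * (‖x‖₊ : ℝ≥0∞) ^ 2 ≠ ⊤ := ENNReal.mul_ne_top hT (by simp)
  have h2 : ∑' n : ℕ, (‖T n x‖₊ : ℝ≥0∞) ^ 2 ≠ ⊤ := ne_top_of_le_ne_top hfin h
  constructor
  · have := ENNReal.summable_toReal h2
    simpa using this
  · have := ENNReal.toReal_mono hfin h
    rw [ENNReal.tsum_toReal_eq (by simp)] at this
    simpa using this

/-- The column operator. -/
theorem exists_column (T : ℕ → H →L[ℂ] H) (hT : sotNormSq T ≠ ⊤) :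
    ∃ C : H →L[ℂ] ellTwo H, (∀ x k, C x k = T k x) ∧
      ‖C‖ ^ 2 ≤ (sotNormSq T).toReal := by
  have hmem : ∀ x, Memℓp (fun k => T k x) 2 := fun x => by
    apply memℓp_gen
    simpa using (hasSum_sot T hT x).1
  let L : H →ₗ[ℂ] ellTwo H :=
    { toFun := fun x => ⟨fun k => T k x, hmem x⟩
      map_add' := fun x y => by ext k; exact map_add (T k) x y
      map_smul' := fun c x => by ext k; exact map_smul (T k) c x }
  have hL : ∀ x, ‖L x‖ ≤ √(sotNormSq T).toReal * ‖x‖ := fun x => by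
    have h1 : ‖L x‖ ^ 2 = ∑' n, ‖T n x‖ ^ 2 := by
      have := lp.norm_rpow_eq_tsum (p := 2) (by simp) (L x)
      simp only [ENNReal.toReal_ofNat, Real.rpow_two] at this
      exact this
    have h2 := (hasSum_sot T hT x).2
    refine (sq_le_sq₀ (norm_nonneg _) (by positivity)).1 ?_
    rw [h1, mul_pow, Real.sq_sqrt ENNReal.toReal_nonneg]
    exact h2
  refine ⟨L.mkContinuous _ hL, fun x k => rfl, ?_⟩
  have := L.mkContinuous_norm_le (Real.sqrt_nonneg _) hL
  calc _ ≤ (√(sotNormSq T).toReal) ^ 2 := by gcongr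
    _ = _ := Real.sq_sqrt ENNReal.toReal_nonneg

theorem exists_of_columns (T : ℕ → ℕ → H →L[ℂ] H)
    (hM : ∑' j : ℕ, sotNormSq (fun k => T k j) ≠ ⊤) :
    ∃ A : ellTwo H →L[ℂ] ellTwo H, Represents T A ∧
      (‖A‖₊ : ℝ≥0∞) ^ 2 ≤ ∑' j : ℕ, sotNormSq (fun k => T k j) := by
  have hj : ∀ j, sotNormSq (fun k => T k j) ≠ ⊤ := ENNReal.ne_top_of_tsum_ne_top hM
  choose C hC hCn using fun j => exists_column (fun k => T k j) (hj j)
  have hs := ENNReal.summable_toReal hM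
  have hCs : Summable (fun j => ‖C j‖ ^ 2) :=
    Summable.of_nonneg_of_le (fun _ => by positivity) hCn hs
  set M : ℝ := (∑' j : ℕ, sotNormSq (fun k => T k j)).toReal with hMdef
  have hCM : ∑' j, ‖C j‖ ^ 2 ≤ M := by
    rw [hMdef, ENNReal.tsum_toReal_eq hj]
    exact hCs.tsum_le_tsum hCn hs
  have hx2 : ∀ x : ellTwo H, HasSum (fun j => ‖x j‖ ^ 2) (‖x‖ ^ 2) := fun x => by
    simpa using lp.hasSum_norm (p := 2) (by simp) x
  have hol : ∀ x : ellTwo H, Summable (fun j => ‖C j‖ * ‖x j‖) ∧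
      ∑' j, ‖C j‖ * ‖x j‖ ≤ √M * ‖x‖ := fun x => by
    have hc : (2 : ℝ).HolderConjugate 2 := Real.HolderConjugate.two_two
    have a1 : Summable (fun j => ‖C j‖ ^ (2 : ℝ)) := by simpa using hCs
    have a2 : Summable (fun j => ‖x j‖ ^ (2 : ℝ)) := by simpa using (hx2 x).summable
    refine ⟨Real.summable_mul_of_Lp_Lq_of_nonneg hc (fun j => norm_nonneg (C j))
      (fun _ => norm_nonneg _) a1 a2, ?_⟩
    refine (Real.inner_le_Lp_mul_Lq_tsum_of_nonneg hc (fun j => norm_nonneg (C j))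
      (fun _ => norm_nonneg _) a1 a2).trans ?_
    simp only [Real.rpow_two, ← Real.sqrt_eq_rpow, (hx2 x).tsum_eq]
    rw [Real.sqrt_sq (norm_nonneg _)]
    gcongr
  have hsn : ∀ x : ellTwo H, Summable (fun j => ‖C j (x j)‖) := fun x =>
    Summable.of_nonneg_of_le (fun _ => norm_nonneg _) (fun j => (C j).le_opNorm _) (hol x).1
  have hsum : ∀ x : ellTwo H, Summable (fun j => C j (x j)) := fun x => (hsn x).of_norm
  let L : ellTwo H →ₗ[ℂ] ellTwo H :=
    { toFun := fun x => ∑' j, C j (x j)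
      map_add' := fun x y => by
        rw [← (hsum x).tsum_add (hsum y)]
        simp
      map_smul' := fun c x => by
        rw [RingHom.id_apply, ← (hsum x).tsum_const_smul c]
        simp }
  have hL : ∀ x, ‖L x‖ ≤ √M * ‖x‖ := fun x =>
    (norm_tsum_le_tsum_norm (hsn x)).trans
      (((hsn x).tsum_le_tsum (fun j => (C j).le_opNorm _) (hol x).1).trans (hol x).2)
  refine ⟨L.mkContinuous _ hL, ?_, ?_⟩
  · intro j x k
    have : L (lp.single 2 j x) = C j x := by
      change ∑' i, C i ((lp.single 2 j x : ellTwo H) i) = C j x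
      rw [tsum_eq_single j]
      · simp
      · intro i hi
        simp [Pi.single_eq_of_ne hi]
    rw [LinearMap.mkContinuous_apply, this, hC]
  · have h := L.mkContinuous_norm_le (Real.sqrt_nonneg _) hL
    have h2 : ‖L.mkContinuous _ hL‖ ^ 2 ≤ M := by
      calc _ ≤ (√M) ^ 2 := by gcongr
        _ = _ := Real.sq_sqrt ENNReal.toReal_nonneg
    rw [← ENNReal.ofReal_toReal hM, ← hMdef]
    refine le_trans (le_of_eq ?_) (ENNReal.ofReal_le_ofReal h2)
    rw [ENNReal.ofReal_pow (norm_nonneg _), ofReal_norm]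
    rfl

theorem exists_of_rows (T : ℕ → ℕ → H →L[ℂ] H)
    (hM : ∑' k : ℕ, sotNormSq (fun j => ContinuousLinearMap.adjoint (T k j)) ≠ ⊤) :
    ∃ A : ellTwo H →L[ℂ] ellTwo H, Represents T A ∧
      (‖A‖₊ : ℝ≥0∞) ^ 2 ≤
        ∑' k : ℕ, sotNormSq (fun j => ContinuousLinearMap.adjoint (T k j)) := by
  obtain ⟨B, hB, hBn⟩ :=
    exists_of_columns (fun j k => ContinuousLinearMap.adjoint (T k j)) hM
  refine ⟨ContinuousLinearMap.adjoint B, ?_, ?_⟩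
  · intro j x k
    refine ext_inner_right ℂ fun y => ?_
    rw [← lp.inner_single_right, ContinuousLinearMap.adjoint_inner_left, lp.inner_single_left,
      hB, ContinuousLinearMap.adjoint_inner_right]
  · rwa [LinearIsometryEquiv.nnnorm_map]

theorem bounded_of_square_summable_sot_columns_or_rows
    (T : ℕ → ℕ → H →L[ℂ] H)
    (hM : min (∑' j : ℕ, sotNormSq (fun k => T k j))
        (∑' k : ℕ, sotNormSq (fun j => ContinuousLinearMap.adjoint (T k j))) < ⊤) :
    ∃ A : ellTwo H →L[ℂ] ellTwo H, Represents T A ∧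
      (‖A‖₊ : ℝ≥0∞) ^ 2 ≤
        min (∑' j : ℕ, sotNormSq (fun k => T k j))
          (∑' k : ℕ, sotNormSq (fun j => ContinuousLinearMap.adjoint (T k j))) := by
  rcases le_total (∑' j : ℕ, sotNormSq (fun k => T k j))
    (∑' k : ℕ, sotNormSq (fun j => ContinuousLinearMap.adjoint (T k j))) with h | h
  · rw [min_eq_left h] at hM ⊢
    exact exists_of_columns T hM.ne
  · rw [min_eq_right h] at hM ⊢
    exact exists_of_rows T hM.ne

end
end

section
/- Let H be a complex separable Hilbert space and let A=(T_{kj})_{k,j≥1} be a matrix with entries in B(H) such that ‖A‖_{H̃²(𝕋²,B(H))} < ∞. Then A belongs to B(ℓ²(H)) and ‖A‖_{B(ℓ²(H))} ≤ ‖A‖_{H̃²(𝕋²,B(H))}. -/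
open scoped ENNReal NNReal ComplexConjugate
open MeasureTheory Complex

noncomputable section

variable {H : Type*} [NormedAddCommGroup H] [InnerProductSpace ℂ H] [CompleteSpace H]

/-- The square of the `H̃²(𝕋², B(H))` norm of a matrix `(T k j)` (indices starting at `1`, so the
entry `T k j` carries the characters `e^{i(j+1)t}` and `e^{i(k+1)s}`):
`sup_{N,M} ∫₀^{2π}∫₀^{2π} ‖Σ_{j=1}^N Σ_{k=1}^M T_{kj} e^{ijt}e^{iks}‖² dt/2π ds/2π`. -/
def h2MatNormSq (T : ℕ → ℕ → H →L[ℂ] H) : ℝ≥0∞ :=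
  ⨆ (N : ℕ) (M : ℕ),
    (∫⁻ t in Set.Ioc (0 : ℝ) (2 * Real.pi), ∫⁻ s in Set.Ioc (0 : ℝ) (2 * Real.pi),
        ((‖∑ j ∈ Finset.range N, ∑ k ∈ Finset.range M,
            (Complex.exp (((j : ℝ) + 1) * t * Complex.I) *
              Complex.exp (((k : ℝ) + 1) * s * Complex.I)) • T k j‖₊ : ℝ≥0∞) ^ 2)) /
      (ENNReal.ofReal (2 * Real.pi)) ^ 2

def ee (j : ℕ) (t : ℝ) : ℂ := Complex.exp (((j : ℝ) + 1) * t * Complex.I)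

lemma ee_cont (j : ℕ) : Continuous (ee j) := by unfold ee; fun_prop

lemma ee_conj (j : ℕ) (t : ℝ) : conj (ee j t) = Complex.exp (-(((j : ℝ) + 1) * t * Complex.I)) := by
  unfold ee
  rw [← Complex.exp_conj]; simp

lemma ee_orth (i j : ℕ) : ∫ t in Set.Ioc (0 : ℝ) (2 * Real.pi), conj (ee i t) * ee j t =
    if i = j then (2 * Real.pi : ℂ) else 0 := by
  rw [← intervalIntegral.integral_of_le (by positivity)]
  have h1 : ∀ t : ℝ, conj (ee i t) * ee j t = Complex.exp ((((j : ℂ) - i) * Complex.I) * t) := by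
    intro t
    rw [ee_conj, ee, ← Complex.exp_add]
    congr 1; push_cast; ring
  simp_rw [h1]
  split_ifs with hij
  · subst hij; simp
  · have hne : ((j : ℂ) - i) * Complex.I ≠ 0 := by
      refine mul_ne_zero (sub_ne_zero.2 ?_) Complex.I_ne_zero
      exact_mod_cast (Ne.symm hij)
    rw [integral_exp_mul_complex hne]
    have : Complex.exp (((j : ℂ) - i) * Complex.I * ((2 * Real.pi : ℝ) : ℂ)) = 1 := by
      rw [Complex.exp_eq_one_iff]
      exact ⟨(j : ℤ) - i, by push_cast; ring⟩
    rw [this]; simp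

lemma ee_orth' (i j : ℕ) : ∫ t in Set.Ioc (0 : ℝ) (2 * Real.pi), conj (conj (ee i t)) * conj (ee j t) =
    if i = j then (2 * Real.pi : ℂ) else 0 := by
  have := ee_orth j i
  simp_rw [Complex.conj_conj, mul_comm (ee i _)]
  rw [this]; simp [eq_comm]

lemma pars (E : ℕ → ℝ → ℂ) (hE : ∀ j, Continuous (E j))
    (ho : ∀ i j, ∫ t in Set.Ioc (0 : ℝ) (2 * Real.pi), conj (E i t) * E j t =
      if i = j then (2 * Real.pi : ℂ) else 0) (N : ℕ) (a b : ℕ → H) :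
    ∫ t in Set.Ioc (0 : ℝ) (2 * Real.pi), inner ℂ (∑ j ∈ Finset.range N, E j t • a j)
      (∑ j ∈ Finset.range N, E j t • b j) = 2 * Real.pi * ∑ j ∈ Finset.range N, inner ℂ (a j) (b j) := by
  have hi : ∀ i j, Integrable (fun t => conj (E i t) * E j t * inner ℂ (a i) (b j))
      (volume.restrict (Set.Ioc (0 : ℝ) (2 * Real.pi))) := by
    intro i j
    have : Continuous (fun t => conj (E i t) * E j t * inner ℂ (a i) (b j)) := by
      have := hE i; have := hE j; fun_prop
    exact (this.integrableOn_Icc (a := 0) (b := 2 * Real.pi)).mono_set Set.Ioc_subset_Icc_self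
  simp_rw [sum_inner, inner_sum, inner_smul_left, inner_smul_right, ← mul_assoc]
  rw [integral_finsetSum _ (fun i _ => integrable_finsetSum _ fun j _ => hi i j)]
  rw [Finset.mul_sum]
  refine Finset.sum_congr rfl fun i hi' => ?_
  rw [integral_finsetSum _ (fun j _ => hi i j)]
  simp_rw [integral_mul_const, ho]
  simp [hi']

lemma pars_l (E : ℕ → ℝ → ℂ) (hE : ∀ j, Continuous (E j))
    (ho : ∀ i j, ∫ t in Set.Ioc (0 : ℝ) (2 * Real.pi), conj (E i t) * E j t =
      if i = j then (2 * Real.pi : ℂ) else 0) (N : ℕ) (a : ℕ → H) :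
    ∫⁻ t in Set.Ioc (0 : ℝ) (2 * Real.pi), ‖∑ j ∈ Finset.range N, E j t • a j‖ₑ ^ 2
     = ENNReal.ofReal (2 * Real.pi * ∑ j ∈ Finset.range N, ‖a j‖ ^ 2) := by
  have h := pars E hE ho N a a
  simp_rw [inner_self_eq_norm_sq_to_K] at h
  have hc : Continuous fun t => ‖∑ j ∈ Finset.range N, E j t • a j‖ ^ 2 := by fun_prop
  have h2 : ∫ t in Set.Ioc (0 : ℝ) (2 * Real.pi), ‖∑ j ∈ Finset.range N, E j t • a j‖ ^ 2
     = (2 * Real.pi * ∑ j ∈ Finset.range N, ‖a j‖ ^ 2) := by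
    have h' := h
    norm_cast at h'
    apply Complex.ofReal_injective
    rw [Complex.ofReal_mul]
    exact h'
  rw [← h2, ofReal_integral_eq_lintegral_ofReal]
  · refine lintegral_congr fun t => ?_
    rw [ENNReal.ofReal_pow (norm_nonneg _), ofReal_norm]
  · exact (hc.integrableOn_Icc (a := 0) (b := 2 * Real.pi)).mono_set Set.Ioc_subset_Icc_self
  · exact Filter.Eventually.of_forall fun t => by positivity

lemma CS {μ : Measure ℝ} {f g : ℝ → ℝ≥0∞} (hf : AEMeasurable f μ) (hg : AEMeasurable g μ) :
    ∫⁻ a, f a * g a ∂μ ≤ (∫⁻ a, f a ^ 2 ∂μ) ^ (1/2:ℝ) * (∫⁻ a, g a ^ 2 ∂μ) ^ (1/2:ℝ) := by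
  have := ENNReal.lintegral_mul_le_Lp_mul_Lq μ Real.HolderConjugate.two_two hf hg
  simpa using this

lemma key (T : ℕ → ℕ → H →L[ℂ] H) (N M : ℕ) (x y : ℕ → H) :
    ∫ t in Set.Ioc (0 : ℝ) (2 * Real.pi), ∫ s in Set.Ioc (0 : ℝ) (2 * Real.pi),
      inner ℂ (∑ k ∈ Finset.range M, ee k s • y k)
        ((∑ j ∈ Finset.range N, ∑ k ∈ Finset.range M, (ee j t * ee k s) • T k j)
          (∑ j ∈ Finset.range N, conj (ee j t) • x j)) =
    (2 * Real.pi) * ((2 * Real.pi) * ∑ k ∈ Finset.range M,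
      inner ℂ (y k) (∑ j ∈ Finset.range N, T k j (x j))) := by
  have h1 : ∀ t s : ℝ, ((∑ j ∈ Finset.range N, ∑ k ∈ Finset.range M, (ee j t * ee k s) • T k j)
          (∑ j ∈ Finset.range N, conj (ee j t) • x j)) = ∑ k ∈ Finset.range M, ee k s •
          (∑ j ∈ Finset.range N, ee j t • T k j (∑ j ∈ Finset.range N, conj (ee j t) • x j)) := by
    intro t s
    simp only [sum_apply, smul_apply]
    rw [Finset.sum_comm]
    simp_rw [Finset.smul_sum, smul_smul, mul_comm]
  simp_rw [h1]
  simp_rw [pars ee ee_cont ee_orth]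
  rw [integral_const_mul]
  congr 1
  have h2 : ∀ t : ℝ, ∑ k ∈ Finset.range M, inner ℂ (y k)
      (∑ j ∈ Finset.range N, ee j t • T k j (∑ j ∈ Finset.range N, conj (ee j t) • x j)) =
      inner ℂ (∑ j ∈ Finset.range N, conj (ee j t) • 
          ∑ k ∈ Finset.range M, ContinuousLinearMap.adjoint (T k j) (y k))
        (∑ j ∈ Finset.range N, conj (ee j t) • x j) := by
    intro t
    generalize (∑ j ∈ Finset.range N, conj (ee j t) • x j) = f
    simp_rw [sum_inner, inner_smul_left, inner_sum, inner_smul_right, sum_inner,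
      ContinuousLinearMap.adjoint_inner_left, Complex.conj_conj, Finset.mul_sum]
    rw [Finset.sum_comm]
  simp_rw [h2]
  rw [pars (fun j t => conj (ee j t)) (fun j => Complex.continuous_conj.comp (ee_cont j)) ee_orth']
  congr 1
  simp_rw [inner_sum, sum_inner, ContinuousLinearMap.adjoint_inner_left]
  rw [Finset.sum_comm]

lemma bound1 (T : ℕ → ℕ → H →L[ℂ] H) (N M : ℕ) (x y : ℕ → H) :
    ENNReal.ofReal (2 * Real.pi) ^ 2 * ‖∑ k ∈ Finset.range M,
      inner ℂ (y k) (∑ j ∈ Finset.range N, T k j (x j))‖ₑ ≤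
    (∫⁻ t in Set.Ioc (0 : ℝ) (2 * Real.pi), ∫⁻ s in Set.Ioc (0 : ℝ) (2 * Real.pi),
      ‖∑ j ∈ Finset.range N, ∑ k ∈ Finset.range M, (ee j t * ee k s) • T k j‖ₑ ^ 2) ^ (1/2:ℝ) *
    (ENNReal.ofReal (2 * Real.pi * ∑ j ∈ Finset.range N, ‖x j‖ ^ 2)) ^ (1/2:ℝ) *
    (ENNReal.ofReal (2 * Real.pi * ∑ j ∈ Finset.range M, ‖y j‖ ^ 2)) ^ (1/2:ℝ) := by
  set P : ℝ → ℝ → H →L[ℂ] H := fun t s =>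
    ∑ j ∈ Finset.range N, ∑ k ∈ Finset.range M, (ee j t * ee k s) • T k j with hP
  set f : ℝ → H := fun t => ∑ j ∈ Finset.range N, conj (ee j t) • x j with hf
  set g : ℝ → H := fun s => ∑ k ∈ Finset.range M, ee k s • y k with hg
  have hPc : Continuous (Function.uncurry P) := by
    have := ee_cont
    simp only [hP, Function.uncurry_def]
    fun_prop
  have hfc : Continuous f := by
    have : ∀ j, Continuous (fun t => conj (ee j t)) :=
      fun j => Complex.continuous_conj.comp (ee_cont j)
    fun_prop
  have hgc : Continuous g := by have := ee_cont; fun_prop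
  have hfl := pars_l (fun j t => conj (ee j t)) 
    (fun j => Complex.continuous_conj.comp (ee_cont j)) ee_orth' N x
  have hgl := pars_l ee ee_cont ee_orth M y
  have hk := key T N M x y
  have hl : ENNReal.ofReal (2 * Real.pi) ^ 2 * ‖∑ k ∈ Finset.range M,
      inner ℂ (y k) (∑ j ∈ Finset.range N, T k j (x j))‖ₑ =
      ‖∫ t in Set.Ioc (0 : ℝ) (2 * Real.pi), ∫ s in Set.Ioc (0 : ℝ) (2 * Real.pi),
        inner ℂ (g s) (P t s (f t))‖ₑ := by
    have e2 : ‖(2 * Real.pi : ℂ)‖ₑ = ENNReal.ofReal (2 * Real.pi) := by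
      rw [← ofReal_norm]; congr 1; simp [Real.pi_pos.le]
    rw [hk]
    generalize (2 * Real.pi : ℂ) = c at e2 ⊢
    rw [enorm_mul, enorm_mul, e2]; ring
  rw [hl, ← hfl, ← hgl]
  have hm : Measurable (fun p : ℝ × ℝ => ‖P p.1 p.2‖ₑ ^ 2) :=
    (by exact hPc.enorm.measurable : Measurable (fun p : ℝ × ℝ => ‖P p.1 p.2‖ₑ)).pow_const 2
  have hm2 : Measurable (fun t => ∫⁻ s in Set.Ioc (0 : ℝ) (2 * Real.pi), ‖P t s‖ₑ ^ 2) :=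
    hm.lintegral_prod_right'
  calc _ ≤ ∫⁻ t in Set.Ioc (0 : ℝ) (2 * Real.pi), ∫⁻ s in Set.Ioc (0 : ℝ) (2 * Real.pi),
        ‖f t‖ₑ * (‖P t s‖ₑ * ‖g s‖ₑ) := by
        refine (enorm_integral_le_lintegral_enorm _).trans (lintegral_mono fun t => ?_)
        refine (enorm_integral_le_lintegral_enorm _).trans (lintegral_mono fun s => ?_)
        have : ‖(inner ℂ (g s) (P t s (f t)) : ℂ)‖ ≤ ‖f t‖ * (‖P t s‖ * ‖g s‖) :=
          (norm_inner_le_norm _ _).trans (by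
            have := (P t s).le_opNorm (f t)
            calc _ ≤ ‖g s‖ * (‖P t s‖ * ‖f t‖) := by gcongr
              _ = _ := by ring)
        simp only [← ofReal_norm]
        rw [← ENNReal.ofReal_mul (norm_nonneg _), ← ENNReal.ofReal_mul (norm_nonneg _)]
        exact ENNReal.ofReal_le_ofReal this
    _ ≤ ∫⁻ t in Set.Ioc (0 : ℝ) (2 * Real.pi), 
        (‖f t‖ₑ * (∫⁻ s in Set.Ioc (0 : ℝ) (2 * Real.pi), ‖P t s‖ₑ ^ 2) ^ (1/2:ℝ)) *
          (∫⁻ s in Set.Ioc (0 : ℝ) (2 * Real.pi), ‖g s‖ₑ ^ 2) ^ (1/2:ℝ) := by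
        refine lintegral_mono fun t => ?_
        have hPt : Continuous (P t) := by fun_prop
        have := CS (μ := volume.restrict (Set.Ioc (0 : ℝ) (2 * Real.pi)))
          hPt.enorm.measurable.aemeasurable hgc.enorm.measurable.aemeasurable
        dsimp only
        rw [lintegral_const_mul _ (by exact hPt.enorm.measurable.mul hgc.enorm.measurable), mul_assoc]
        gcongr
    _ = (∫⁻ t in Set.Ioc (0 : ℝ) (2 * Real.pi), 
        (‖f t‖ₑ * (∫⁻ s in Set.Ioc (0 : ℝ) (2 * Real.pi), ‖P t s‖ₑ ^ 2) ^ (1/2:ℝ))) *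
          (∫⁻ s in Set.Ioc (0 : ℝ) (2 * Real.pi), ‖g s‖ₑ ^ 2) ^ (1/2:ℝ) := by
        rw [lintegral_mul_const _ (by exact hfc.enorm.measurable.mul (hm2.pow_const _))]
    _ ≤ _ := by
        gcongr
        have := CS (μ := volume.restrict (Set.Ioc (0 : ℝ) (2 * Real.pi)))
          hfc.enorm.measurable.aemeasurable (hm2.pow_const (1/2:ℝ)).aemeasurable
        refine this.trans (le_of_eq ?_)
        rw [mul_comm]
        congr 2
        refine lintegral_congr fun t => ?_
        rw [← ENNReal.rpow_natCast, ← ENNReal.rpow_mul]; norm_num; rfl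

lemma bound2 (T : ℕ → ℕ → H →L[ℂ] H) (h : h2MatNormSq T < ⊤) (N M : ℕ) (x y : ℕ → H) :
    ‖∑ k ∈ Finset.range M, inner ℂ (y k) (∑ j ∈ Finset.range N, T k j (x j))‖ ^ 2 ≤
    (h2MatNormSq T).toReal * (∑ j ∈ Finset.range N, ‖x j‖ ^ 2) *
      ∑ j ∈ Finset.range M, ‖y j‖ ^ 2 := by
  have h1 := bound1 T N M x y
  set I := ∫⁻ t in Set.Ioc (0 : ℝ) (2 * Real.pi), ∫⁻ s in Set.Ioc (0 : ℝ) (2 * Real.pi),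
      ‖∑ j ∈ Finset.range N, ∑ k ∈ Finset.range M, (ee j t * ee k s) • T k j‖ₑ ^ 2 with hI
  have h2 : I / (ENNReal.ofReal (2 * Real.pi)) ^ 2 ≤ h2MatNormSq T :=
    le_iSup₂_of_le (f := fun N M => (∫⁻ t in Set.Ioc (0 : ℝ) (2 * Real.pi),
      ∫⁻ s in Set.Ioc (0 : ℝ) (2 * Real.pi),
        ((‖∑ j ∈ Finset.range N, ∑ k ∈ Finset.range M,
            (Complex.exp (((j : ℝ) + 1) * t * Complex.I) *
              Complex.exp (((k : ℝ) + 1) * s * Complex.I)) • T k j‖₊ : ℝ≥0∞) ^ 2)) /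
      (ENNReal.ofReal (2 * Real.pi)) ^ 2) N M le_rfl
  have hpi : (0:ℝ) < 2 * Real.pi := by positivity
  rw [ENNReal.div_le_iff (by simp [Real.pi_pos]) (ENNReal.pow_ne_top ENNReal.ofReal_ne_top)] at h2
  have hK : h2MatNormSq T = ENNReal.ofReal (h2MatNormSq T).toReal :=
    (ENNReal.ofReal_toReal h.ne).symm
  set K := (h2MatNormSq T).toReal
  have hK0 : 0 ≤ K := ENNReal.toReal_nonneg
  set X := ∑ j ∈ Finset.range N, ‖x j‖ ^ 2
  set Y := ∑ j ∈ Finset.range M, ‖y j‖ ^ 2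
  have hX : 0 ≤ X := by positivity
  have hY : 0 ≤ Y := by positivity
  rw [hK] at h2
  clear_value I K X Y
  generalize (∑ k ∈ Finset.range M, inner ℂ (y k) (∑ j ∈ Finset.range N, T k j (x j))) = Z at h1 ⊢
  clear hI
  generalize 2 * Real.pi = p at h1 h2 hpi
  have hsq : ∀ u : ℝ≥0∞, (u ^ (1/2:ℝ)) ^ 2 = u := by
    intro u
    rw [← ENNReal.rpow_natCast, ← ENNReal.rpow_mul]; norm_num
  have h3 := pow_le_pow_left' h1 2
  simp only [mul_pow, hsq] at h3
  have h4 : (ENNReal.ofReal p ^ 2) ^ 2 * ‖Z‖ₑ ^ 2 ≤ ENNReal.ofReal K * ENNReal.ofReal p ^ 2 *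
      ENNReal.ofReal (p * X) * ENNReal.ofReal (p * Y) := by
    refine h3.trans ?_
    gcongr
  rw [← ofReal_norm] at h4
  simp only [← ENNReal.ofReal_pow hpi.le, ← ENNReal.ofReal_pow (norm_nonneg Z),
    ← ENNReal.ofReal_pow (sq_nonneg p)] at h4
  rw [← ENNReal.ofReal_mul (by positivity), ← ENNReal.ofReal_mul (by positivity),
    ← ENNReal.ofReal_mul (by positivity), ← ENNReal.ofReal_mul (by positivity),
    ENNReal.ofReal_le_ofReal_iff (by positivity)] at h4
  have hp4 : 0 < (p ^ 2) ^ 2 := by positivity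
  refine le_of_mul_le_mul_left (h4.trans (le_of_eq ?_)) hp4
  ring

lemma bound3 (T : ℕ → ℕ → H →L[ℂ] H) (h : h2MatNormSq T < ⊤) (N M : ℕ) (x : ℕ → H) :
    ∑ k ∈ Finset.range M, ‖∑ j ∈ Finset.range N, T k j (x j)‖ ^ 2 ≤
    (h2MatNormSq T).toReal * (∑ j ∈ Finset.range N, ‖x j‖ ^ 2) := by
  have h1 := bound2 T h N M x (fun k => ∑ j ∈ Finset.range N, T k j (x j))
  have h2 : ‖∑ k ∈ Finset.range M, inner ℂ (∑ j ∈ Finset.range N, T k j (x j))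
      (∑ j ∈ Finset.range N, T k j (x j))‖ = 
      ∑ k ∈ Finset.range M, ‖∑ j ∈ Finset.range N, T k j (x j)‖ ^ 2 := by
    simp_rw [inner_self_eq_norm_sq_to_K]
    norm_cast
    exact abs_of_nonneg (Finset.sum_nonneg fun _ _ => sq_nonneg _)
  rw [h2] at h1
  set Z := ∑ k ∈ Finset.range M, ‖∑ j ∈ Finset.range N, T k j (x j)‖ ^ 2
  have hZ : 0 ≤ Z := by positivity
  rcases hZ.eq_or_lt with h0 | h0
  · rw [← h0]; positivity
  · rw [sq] at h1; exact le_of_mul_le_mul_right h1 h0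

lemma bound4 (T : ℕ → ℕ → H →L[ℂ] H) (h : h2MatNormSq T < ⊤) (S R : Finset ℕ) (x : ℕ → H) :
    ∑ k ∈ R, ‖∑ j ∈ S, T k j (x j)‖ ^ 2 ≤
    (h2MatNormSq T).toReal * (∑ j ∈ S, ‖x j‖ ^ 2) := by
  obtain ⟨N, hN⟩ := S.exists_nat_subset_range
  obtain ⟨M, hM⟩ := R.exists_nat_subset_range
  have h1 := bound3 T h N M (fun j => if j ∈ S then x j else 0)
  have e1 : ∀ k, ∑ j ∈ Finset.range N, T k j (if j ∈ S then x j else 0) = ∑ j ∈ S, T k j (x j) := by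
    intro k
    rw [← Finset.sum_subset hN]
    · exact Finset.sum_congr rfl fun j hj => by simp [hj]
    · intro j _ hj; simp [hj]
  have e2 : ∑ j ∈ Finset.range N, ‖if j ∈ S then x j else 0‖ ^ 2 = ∑ j ∈ S, ‖x j‖ ^ 2 := by
    rw [← Finset.sum_subset hN]
    · exact Finset.sum_congr rfl fun j hj => by simp [hj]
    · intro j _ hj; simp [hj]
  simp_rw [e1] at h1
  rw [e2] at h1
  exact (Finset.sum_le_sum_of_subset_of_nonneg hM fun _ _ _ => by positivity).trans h1

lemma x_bd (x : ellTwo H) (S : Finset ℕ) : ∑ j ∈ S, ‖x j‖ ^ 2 ≤ ‖x‖ ^ 2 := by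
  have := lp.sum_rpow_le_norm_rpow (p := 2) (by norm_num) x S
  simpa using this

lemma summ (T : ℕ → ℕ → H →L[ℂ] H) (h : h2MatNormSq T < ⊤) (x : ellTwo H) (k : ℕ) :
    Summable (fun j => T k j (x j)) := by
  have hs : Summable (fun j => ‖x j‖ ^ 2) := by
    have := (lp.memℓp x).summable (by norm_num)
    simpa using this
  rw [summable_iff_vanishing_norm] at hs ⊢
  intro ε hε
  set K := (h2MatNormSq T).toReal with hK
  have hK0 : 0 ≤ K := ENNReal.toReal_nonneg
  obtain ⟨s, hs⟩ := hs (ε ^ 2 / (K + 1)) (by positivity)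
  refine ⟨s, fun t ht => ?_⟩
  have h1 := hs t ht
  rw [Real.norm_of_nonneg (by positivity), lt_div_iff₀ (by positivity)] at h1
  have h2 := bound4 T h t {k} x
  rw [Finset.sum_singleton] at h2
  refine lt_of_pow_lt_pow_left₀ 2 hε.le (h2.trans_lt ?_)
  have : 0 ≤ ∑ j ∈ t, ‖x j‖ ^ 2 := by positivity
  nlinarith

lemma bound5 (T : ℕ → ℕ → H →L[ℂ] H) (h : h2MatNormSq T < ⊤) (R : Finset ℕ) (x : ellTwo H) :
    ∑ k ∈ R, ‖∑' j, T k j (x j)‖ ^ 2 ≤ (h2MatNormSq T).toReal * ‖x‖ ^ 2 := by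
  have ht : Filter.Tendsto (fun S : Finset ℕ => ∑ k ∈ R, ‖∑ j ∈ S, T k j (x j)‖ ^ 2) Filter.atTop
      (nhds (∑ k ∈ R, ‖∑' j, T k j (x j)‖ ^ 2)) :=
    tendsto_finsetSum _ fun k _ => ((summ T h x k).hasSum.norm).pow 2
  refine le_of_tendsto ht (Filter.Eventually.of_forall fun S => ?_)
  refine (bound4 T h S R x).trans ?_
  gcongr
  exact x_bd x S

theorem bounded_of_h2_norm_finite
    (T : ℕ → ℕ → H →L[ℂ] H) (h : h2MatNormSq T < ⊤) :
    ∃ A : ellTwo H →L[ℂ] ellTwo H, Represents T A ∧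
      (‖A‖₊ : ℝ≥0∞) ^ 2 ≤ h2MatNormSq T := by
  have hK0 : 0 ≤ (h2MatNormSq T).toReal := ENNReal.toReal_nonneg
  let L : ellTwo H →ₗ[ℂ] ellTwo H :=
    { toFun := fun x => ⟨fun k => ∑' j, T k j (x j),
        memℓp_gen' (C := (h2MatNormSq T).toReal * ‖x‖ ^ 2) fun s => by
          simpa using bound5 T h s x⟩
      map_add' := fun x y => by
        ext k
        simp only [lp.coeFn_add, Pi.add_apply, map_add]
        exact (summ T h x k).tsum_add (summ T h y k)
      map_smul' := fun c x => by
        ext k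
        simp only [lp.coeFn_smul, Pi.smul_apply, map_smul, RingHom.id_apply]
        exact (summ T h x k).tsum_const_smul c }
  have hL : ∀ x k, L x k = ∑' j, T k j (x j) := fun x k => rfl
  have hb : ∀ x, ‖L x‖ ≤ √(h2MatNormSq T).toReal * ‖x‖ := by
    intro x
    refine lp.norm_le_of_forall_sum_le (by norm_num) (by positivity) fun s => ?_
    have := bound5 T h s x
    simp only [hL, ENNReal.toReal_ofNat, Real.rpow_ofNat, mul_pow, Real.sq_sqrt hK0]
    exact this
  refine ⟨L.mkContinuous _ hb, ?_, ?_⟩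
  · intro j x k
    rw [LinearMap.mkContinuous_apply, hL, tsum_eq_single j]
    · rw [lp.single_apply_self]
    · intro i hi
      rw [lp.single_apply_ne _ _ _ hi, map_zero]
  · have h1 := L.mkContinuous_norm_le (Real.sqrt_nonneg _) hb
    have h2 := pow_le_pow_left₀ (norm_nonneg _) h1 2
    rw [Real.sq_sqrt hK0] at h2
    refine le_trans (le_of_eq ?_) ((ENNReal.ofReal_le_ofReal h2).trans
      (ENNReal.ofReal_toReal h.ne).le)
    rw [ENNReal.ofReal_pow (norm_nonneg _), ofReal_norm]
    rfl

end
end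

section
/- Let H = L²(𝕋) be the Hilbert space of square-integrable functions on the circle with norm ‖f‖ = (∫₀^{2π} |f(t)|² dt/2π)^{1/2}, and for j ≥ 1 define T_j ∈ B(H) by T_j(f)(u) = (1/j) e^{iju} f(u). Then ‖T_j‖_{B(H)} = 1/j for every j ≥ 1 (so Σ_{j≥1} ‖T_j‖²_{B(H)} < ∞), while for every t ∈ [0,2π) and every N ≥ 1 one has ‖Σ_{j=1}^N T_j e^{ijt}‖_{B(H)} = Σ_{j=1}^N 1/j; in particular ‖(T_j)‖_{H̃²(𝕋,B(H))} = ∞. -/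
open scoped ENNReal NNReal InnerProductSpace
open MeasureTheory Complex AddCircle

noncomputable section

instance : Fact (0 < 2 * Real.pi) := ⟨by positivity⟩

/-- `L²(𝕋)` with respect to normalized Haar (Lebesgue) measure `dt/2π` on the circle. -/
abbrev L2Circle : Type :=
  Lp ℂ 2 (haarAddCircle : Measure (AddCircle (2 * Real.pi)))

/-- The square of the `H̃²(𝕋, B(H))` norm of a sequence of operators (indices starting at `1`,
so the entry `T n` carries the character `e^{i(n+1)t}`). -/
def h2SeqNormSq {H : Type*} [NormedAddCommGroup H] [InnerProductSpace ℂ H] [CompleteSpace H]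
    (T : ℕ → H →L[ℂ] H) : ℝ≥0∞ :=
  ⨆ N : ℕ,
    (∫⁻ t in Set.Ioc (0 : ℝ) (2 * Real.pi),
        ((‖∑ n ∈ Finset.range N, Complex.exp (((n : ℝ) + 1) * t * Complex.I) • T n‖₊ : ℝ≥0∞) ^ 2)) /
      ENNReal.ofReal (2 * Real.pi)

theorem moe_lower (S : L2Circle →L[ℂ] L2Circle) (g : AddCircle (2 * Real.pi) → ℂ)
    (hg : Continuous g)
    (hS : ∀ f : L2Circle, (S f : AddCircle (2 * Real.pi) → ℂ) =ᵐ[haarAddCircle]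
      fun u => g u * f u) (u0 : AddCircle (2 * Real.pi)) : ‖g u0‖ ≤ ‖S‖ := by
  refine le_of_forall_lt fun s hs => ?_
  obtain ⟨r, hsr, hr⟩ := exists_between hs
  refine lt_of_lt_of_le hsr ?_
  rcases lt_or_ge r 0 with h0 | h0
  · exact h0.le.trans (norm_nonneg _)
  have hA : IsOpen {u | r < ‖g u‖} := isOpen_lt continuous_const hg.norm
  have hpos : 0 < (haarAddCircle : Measure (AddCircle (2 * Real.pi))) {u | r < ‖g u‖} :=
    hA.measure_pos _ ⟨u0, hr⟩
  set f : L2Circle := indicatorConstLp 2 hA.measurableSet (measure_ne_top _ _) (1 : ℂ) with hf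
  have hfpos : 0 < ‖f‖ := by
    rw [hf, norm_indicatorConstLp (by norm_num) (by norm_num)]
    have : 0 < (haarAddCircle : Measure (AddCircle (2 * Real.pi))).real {u | r < ‖g u‖} :=
      ENNReal.toReal_pos hpos.ne' (measure_ne_top _ _)
    simp only [norm_one, one_mul]
    positivity
  have h1 : ‖(r : ℂ) • f‖ ≤ ‖S f‖ := by
    apply Lp.norm_le_norm_of_ae_le
    filter_upwards [hS f, Lp.coeFn_smul (r : ℂ) f,
      (indicatorConstLp_coeFn : (indicatorConstLp 2 hA.measurableSet
        (measure_ne_top haarAddCircle _) (1 : ℂ) : AddCircle (2 * Real.pi) → ℂ) =ᵐ[_] _)]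
      with u h1 h2 h3
    rw [h1, h2, Pi.smul_apply, hf, h3]
    by_cases hu : u ∈ {u | r < ‖g u‖}
    · simp only [Set.indicator_of_mem hu, smul_eq_mul, mul_one, Complex.norm_real,
        Real.norm_of_nonneg h0]
      exact (show r < ‖g u‖ from hu).le
    · simp [Set.indicator_of_notMem hu]
  rw [norm_smul, Complex.norm_real, Real.norm_of_nonneg h0] at h1
  exact le_of_mul_le_mul_right (h1.trans (S.le_opNorm f)) hfpos

theorem moe_norm_cinv (j : ℕ) : ‖(((j : ℕ) + 1 : ℂ))⁻¹‖ = 1 / ((j : ℝ) + 1) := by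
  rw [norm_inv, one_div]
  congr 1
  have : ((j : ℂ) + 1) = ((j + 1 : ℕ) : ℂ) := by push_cast; rfl
  rw [this, Complex.norm_natCast]
  push_cast; rfl

theorem moe_norm_exp (j : ℕ) (t : ℝ) : ‖Complex.exp (((j : ℝ) + 1) * t * Complex.I)‖ = 1 := by
  have : (((j : ℝ) : ℂ) + 1) * t = (((j + 1) * t : ℝ) : ℂ) := by push_cast; rfl
  rw [this, Complex.norm_exp_ofReal_mul_I]

theorem moe_norm_fourier (n : ℤ) (u : AddCircle (2 * Real.pi)) : ‖fourier n u‖ = 1 := by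
  rw [fourier_apply]; exact Circle.norm_coe _

theorem moe_upper (T : ℕ → L2Circle →L[ℂ] L2Circle)
    (hT : ∀ (j : ℕ) (f : L2Circle),
      (T j f : AddCircle (2 * Real.pi) → ℂ) =ᵐ[haarAddCircle]
        fun u => (((j : ℕ) + 1 : ℂ))⁻¹ * (fourier ((j : ℤ) + 1) u * f u)) (j : ℕ) :
    ‖T j‖ ≤ 1 / ((j : ℝ) + 1) := by
  refine ContinuousLinearMap.opNorm_le_bound _ (by positivity) fun f => ?_
  rw [← moe_norm_cinv, ← norm_smul]
  apply Lp.norm_le_norm_of_ae_le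
  filter_upwards [hT j f, Lp.coeFn_smul (((j : ℕ) + 1 : ℂ))⁻¹ f] with u h1 h2
  rw [h1, h2, Pi.smul_apply, smul_eq_mul, norm_mul, norm_mul, norm_mul, moe_norm_fourier, one_mul]

theorem moe_sum (T : ℕ → L2Circle →L[ℂ] L2Circle)
    (hT : ∀ (j : ℕ) (f : L2Circle),
      (T j f : AddCircle (2 * Real.pi) → ℂ) =ᵐ[haarAddCircle]
        fun u => (((j : ℕ) + 1 : ℂ))⁻¹ * (fourier ((j : ℤ) + 1) u * f u)) (c : ℕ → ℂ) (N : ℕ)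
    (f : L2Circle) :
    (((∑ j ∈ Finset.range N, c j • T j) f : L2Circle) : AddCircle (2 * Real.pi) → ℂ)
      =ᵐ[haarAddCircle] fun u => (∑ j ∈ Finset.range N,
        c j * ((((j : ℕ) + 1 : ℂ))⁻¹ * fourier ((j : ℤ) + 1) u)) * f u := by
  induction N with
  | zero =>
    simp only [Finset.range_zero, Finset.sum_empty, zero_mul, ContinuousLinearMap.zero_apply]
    exact Lp.coeFn_zero _ _ _
  | succ N ih =>
    simp only [Finset.sum_range_succ, ContinuousLinearMap.add_apply,
      ContinuousLinearMap.smul_apply] at ih ⊢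
    filter_upwards [ih, hT N f, Lp.coeFn_smul (c N) (T N f),
      Lp.coeFn_add ((∑ j ∈ Finset.range N, c j • T j) f) (c N • T N f)] with u h1 h2 h3 h4
    rw [h4, Pi.add_apply, h1, h3, Pi.smul_apply, h2, smul_eq_mul]
    ring

theorem moe_norm_sum (T : ℕ → L2Circle →L[ℂ] L2Circle)
    (hT : ∀ (j : ℕ) (f : L2Circle),
      (T j f : AddCircle (2 * Real.pi) → ℂ) =ᵐ[haarAddCircle]
        fun u => (((j : ℕ) + 1 : ℂ))⁻¹ * (fourier ((j : ℤ) + 1) u * f u)) (t : ℝ) (N : ℕ) :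
    ‖∑ j ∈ Finset.range N, Complex.exp (((j : ℝ) + 1) * t * Complex.I) • T j‖ =
        ∑ j ∈ Finset.range N, 1 / ((j : ℝ) + 1) := by
  apply le_antisymm
  · refine norm_sum_le_of_le _ fun j _ => ?_
    rw [norm_smul, moe_norm_exp, one_mul]
    exact moe_upper T hT j
  · have h := moe_lower _ _ (by fun_prop) (moe_sum T hT
      (fun j => Complex.exp (((j : ℝ) + 1) * t * Complex.I)) N) ((-t : ℝ) : AddCircle (2 * Real.pi))
    refine le_trans (le_of_eq ?_) h
    have h2 : ∑ j ∈ Finset.range N, Complex.exp (((j : ℝ) + 1) * t * Complex.I) *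
        ((((j : ℕ) + 1 : ℂ))⁻¹ * fourier ((j : ℤ) + 1) ((-t : ℝ) : AddCircle (2 * Real.pi)))
        = ((∑ j ∈ Finset.range N, 1 / ((j : ℝ) + 1) : ℝ) : ℂ) := by
      push_cast
      refine Finset.sum_congr rfl fun j _ => ?_
      rw [fourier_coe_apply, mul_left_comm, ← Complex.exp_add]
      have hpi : (Real.pi : ℂ) ≠ 0 := by exact_mod_cast Real.pi_ne_zero
      have : ((j : ℂ) + 1) * (t : ℂ) * Complex.I + 2 * Real.pi * Complex.I * (((j : ℤ) + 1 : ℤ) : ℂ)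
          * ((-t : ℝ) : ℂ) / ((2 * Real.pi : ℝ) : ℂ) = 0 := by
        push_cast
        field_simp
        ring
      rw [this, Complex.exp_zero, mul_one, one_div]
    rw [h2, Complex.norm_real, Real.norm_of_nonneg]
    exact Finset.sum_nonneg fun j _ => by positivity

theorem multiplication_operator_example
    (T : ℕ → L2Circle →L[ℂ] L2Circle)
    (hT : ∀ (j : ℕ) (f : L2Circle),
      (T j f : AddCircle (2 * Real.pi) → ℂ) =ᵐ[haarAddCircle]
        fun u => (((j : ℕ) + 1 : ℂ))⁻¹ * (fourier ((j : ℤ) + 1) u * f u)) :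
    (∀ j : ℕ, ‖T j‖ = 1 / ((j : ℝ) + 1)) ∧
    (∑' j : ℕ, (‖T j‖₊ : ℝ≥0∞) ^ 2 < ⊤) ∧
    (∀ t ∈ Set.Ico (0 : ℝ) (2 * Real.pi), ∀ N : ℕ, 1 ≤ N →
      ‖∑ j ∈ Finset.range N, Complex.exp (((j : ℝ) + 1) * t * Complex.I) • T j‖ =
        ∑ j ∈ Finset.range N, 1 / ((j : ℝ) + 1)) ∧
    h2SeqNormSq T = ⊤ := by
  have hn : ∀ j : ℕ, ‖T j‖ = 1 / ((j : ℝ) + 1) := by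
    intro j
    refine le_antisymm (moe_upper T hT j) ?_
    have h := moe_lower (T j) (fun u => (((j : ℕ) + 1 : ℂ))⁻¹ * fourier ((j : ℤ) + 1) u)
      (by fun_prop) (fun f => by simpa only [mul_assoc] using hT j f) 0
    rwa [norm_mul, moe_norm_fourier, mul_one, moe_norm_cinv] at h
  refine ⟨hn, ?_, fun t _ N _ => moe_norm_sum T hT t N, ?_⟩
  · have hs : Summable fun j : ℕ => ‖T j‖₊ ^ 2 := by
      rw [← NNReal.summable_coe]
      have h := (summable_nat_add_iff 1).2 (Real.summable_one_div_nat_pow.2 one_lt_two)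
      refine h.congr fun j => ?_
      rw [NNReal.coe_pow, coe_nnnorm, hn]
      push_cast
      rw [div_pow, one_pow]
    have h := ENNReal.tsum_coe_ne_top_iff_summable.2 hs
    simp only [ENNReal.coe_pow] at h
    exact lt_top_iff_ne_top.2 h
  · have key : ∀ N : ℕ, (∫⁻ t in Set.Ioc (0 : ℝ) (2 * Real.pi),
        ((‖∑ n ∈ Finset.range N, Complex.exp (((n : ℝ) + 1) * t * Complex.I) • T n‖₊ : ℝ≥0∞) ^ 2)) /
      ENNReal.ofReal (2 * Real.pi) =
        ENNReal.ofReal (∑ j ∈ Finset.range N, 1 / ((j : ℝ) + 1)) ^ 2 := by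
      intro N
      have : ∀ t : ℝ, (‖∑ n ∈ Finset.range N,
          Complex.exp (((n : ℝ) + 1) * t * Complex.I) • T n‖₊ : ℝ≥0∞) =
          ENNReal.ofReal (∑ j ∈ Finset.range N, 1 / ((j : ℝ) + 1)) := by
        intro t
        rw [← moe_norm_sum T hT t N, ofReal_norm_eq_enorm]
        rfl
      simp only [this]
      rw [lintegral_const, Measure.restrict_apply_univ, Real.volume_Ioc, sub_zero,
        ENNReal.mul_div_cancel_right _ ENNReal.ofReal_ne_top]
      exact (ENNReal.ofReal_pos.2 (by positivity)).ne'
    unfold h2SeqNormSq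
    simp only [key]
    have ht : Filter.Tendsto (fun N : ℕ =>
        ENNReal.ofReal (∑ j ∈ Finset.range N, 1 / ((j : ℝ) + 1)) ^ 2) Filter.atTop (nhds ⊤) := by
      have h1 := ENNReal.tendsto_ofReal_atTop.comp Real.tendsto_sum_range_one_div_nat_succ_atTop
      have h2 := ENNReal.Tendsto.pow (n := 2) h1
      simpa using h2
    exact top_le_iff.1 (le_of_tendsto' ht fun N => le_iSup (fun N : ℕ =>
        ENNReal.ofReal (∑ j ∈ Finset.range N, 1 / ((j : ℝ) + 1)) ^ 2) N)

end
end

section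
/- Let H be a complex separable Hilbert space and let A=(T_{kj})_{k,j≥1} be a Toeplitz matrix with entries in B(H), say T_{kj} = T_{j−k} for a sequence (T_l)_{l∈ℤ} in B(H). Then A belongs to B(ℓ²(H)) if and only if there exists a bounded linear operator S : L¹(𝕋) → B(H) such that S(φ_l) = T_l for every l ∈ ℤ, where φ_l(t)=e^{ilt} and L¹(𝕋) is the space of integrable functions on the circle with norm ∫₀^{2π} |φ(t)| dt/2π. Moreover, in that case ‖A‖_{B(ℓ²(H))} equals the operator norm of S. -/
open scoped ENNReal NNReal InnerProductSpace
open MeasureTheory Complex AddCircle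

noncomputable section

variable {H : Type*} [NormedAddCommGroup H] [InnerProductSpace ℂ H] [CompleteSpace H]

/-- `L¹(𝕋)` with respect to the normalized Haar (Lebesgue) measure `dt/2π` on the circle. -/
abbrev L1Circle : Type :=
  Lp ℂ 1 (haarAddCircle : Measure (AddCircle (2 * Real.pi)))

abbrev Circ := AddCircle (2 * Real.pi)
abbrev haarC : Measure Circ := haarAddCircle

lemma integral_fourier_eq (l : ℤ) :
    ∫ t : Circ, (fourier l t : ℂ) ∂haarC = if l = 0 then 1 else 0 := by
  split_ifs with h
  · subst h; simp
  · exact integral_eq_zero_of_add_right_eq_neg (μ := haarAddCircle)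
      (fourier_add_half_inv_index h (Fact.out))

lemma integrable_cont {E : Type*} [NormedAddCommGroup E] {f : Circ → E} (hf : Continuous f) :
    Integrable f haarC :=
  hf.integrable_of_hasCompactSupport (HasCompactSupport.of_compactSpace f)

lemma integral_fourier_smul {E : Type*} [NormedAddCommGroup E] [NormedSpace ℂ E] [CompleteSpace E]
    (l : ℤ) (x : E) :
    ∫ t : Circ, (fourier l t : ℂ) • x ∂haarC = if l = 0 then x else 0 := by
  rw [integral_smul_const, integral_fourier_eq]
  split_ifs <;> simp

/-- Fejer weights -/
def wt (n : ℕ) (l : ℤ) : ℂ :=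
  (n : ℂ)⁻¹ * ∑ a ∈ Finset.range n, ∑ b ∈ Finset.range n, if (a : ℤ) - b = l then 1 else 0

lemma wt_count (n : ℕ) (l : ℤ) (h : l.natAbs ≤ n) :
    (∑ a ∈ Finset.range n, ∑ b ∈ Finset.range n, if (a : ℤ) - b = l then (1 : ℂ) else 0)
      = (n - l.natAbs : ℕ) := by
  have h1 : ∀ a ∈ Finset.range n, (∑ b ∈ Finset.range n, if (a : ℤ) - b = l then (1 : ℂ) else 0)
      = if (max 0 l ≤ a ∧ (a : ℤ) < min (n : ℤ) (n + l)) then 1 else 0 := by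
    intro a ha
    rw [Finset.mem_range] at ha
    split_ifs with h2
    · rw [Finset.sum_eq_single (((a : ℤ) - l).toNat)]
      · rw [if_pos]; omega
      · intro b hb hne
        rw [if_neg]; omega
      · intro hb
        rw [Finset.mem_range] at hb
        omega
    · apply Finset.sum_eq_zero
      intro b hb
      rw [Finset.mem_range] at hb
      rw [if_neg]; omega
  rw [Finset.sum_congr rfl h1, Finset.sum_boole]
  congr 1
  have : (Finset.range n).filter (fun a : ℕ => max 0 l ≤ (a : ℤ) ∧ (a : ℤ) < min (n : ℤ) (n + l))
      = Finset.Ico (max 0 l).toNat (min (n : ℤ) (n + l)).toNat := by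
    ext a
    simp only [Finset.mem_filter, Finset.mem_range, Finset.mem_Ico]
    omega
  rw [this, Nat.card_Ico]
  omega

lemma wt_tendsto (l : ℤ) : Filter.Tendsto (fun n => wt n l) Filter.atTop (nhds 1) := by
  have h1 : Filter.Tendsto (fun n : ℕ => 1 - (l.natAbs : ℂ) * ((n : ℂ)⁻¹)) Filter.atTop
      (nhds (1 - (l.natAbs : ℂ) * 0)) :=
    tendsto_const_nhds.sub (tendsto_const_nhds.mul (tendsto_inv_atTop_nhds_zero_nat (𝕜 := ℂ)))
  rw [mul_zero, sub_zero] at h1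
  refine h1.congr' ?_
  filter_upwards [Filter.eventually_ge_atTop (l.natAbs + 1)] with n hn
  have hn0 : (n : ℂ) ≠ 0 := by
    have : n ≠ 0 := by omega
    exact_mod_cast this
  rw [wt, wt_count n l (by omega), Nat.cast_sub (by omega)]
  field_simp

/-- Fejer means -/
def fejer {E : Type*} [NormedAddCommGroup E] [NormedSpace ℂ E] (T : ℤ → E) (n : ℕ) (t : Circ) : E :=
  (n : ℂ)⁻¹ • ∑ a ∈ Finset.range n, ∑ b ∈ Finset.range n,
    (fourier (-((a : ℤ) - b)) t : ℂ) • T ((a : ℤ) - b)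

lemma fejer_continuous {E : Type*} [NormedAddCommGroup E] [NormedSpace ℂ E] (T : ℤ → E) (n : ℕ) :
    Continuous (fejer T n) := by
  unfold fejer
  refine continuous_const.smul (continuous_finsetSum _ fun a _ => continuous_finsetSum _ fun b _ => ?_)
  exact (map_continuous (fourier _)).smul continuous_const

lemma integral_fejer {E : Type*} [NormedAddCommGroup E] [NormedSpace ℂ E] [CompleteSpace E]
    (T : ℤ → E) (n : ℕ) (l : ℤ) :
    ∫ t : Circ, (fourier l t : ℂ) • fejer T n t ∂haarC = wt n l • T l := by
  have h : ∀ t : Circ, (fourier l t : ℂ) • fejer T n t = (n : ℂ)⁻¹ • ∑ a ∈ Finset.range n,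
      ∑ b ∈ Finset.range n, (fourier (l - ((a : ℤ) - b)) t : ℂ) • T ((a : ℤ) - b) := by
    intro t
    rw [fejer, smul_comm, Finset.smul_sum]
    congr 1
    refine Finset.sum_congr rfl fun a _ => ?_
    rw [Finset.smul_sum]
    refine Finset.sum_congr rfl fun b _ => ?_
    rw [smul_smul, ← fourier_add, sub_eq_add_neg l]
  have hi : ∀ a b : ℕ, Integrable (fun t : Circ =>
      (fourier (l - ((a : ℤ) - b)) t : ℂ) • T ((a : ℤ) - b)) haarC := fun a b =>
    integrable_cont ((map_continuous (fourier _)).smul continuous_const)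
  simp_rw [h]
  rw [integral_smul, integral_finsetSum _ (fun a _ => integrable_finsetSum _ fun b _ => hi a b)]
  rw [wt, mul_smul, Finset.sum_smul]
  congr 1
  refine Finset.sum_congr rfl fun a _ => ?_
  rw [integral_finsetSum _ (fun b _ => hi a b), Finset.sum_smul]
  refine Finset.sum_congr rfl fun b _ => ?_
  rw [integral_fourier_smul]
  by_cases hl : (a : ℤ) - b = l
  · simp [hl]
  · rw [if_neg (by omega), if_neg hl, zero_smul]

lemma norm_toLp_eq (g : C(Circ, ℂ)) :
    ‖(ContinuousMap.toLp (E := ℂ) 1 haarAddCircle ℂ g : L1Circle)‖ = ∫ t, ‖g t‖ ∂haarC := by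
  rw [L1.norm_eq_integral_norm]
  apply integral_congr_ae
  filter_upwards [ContinuousMap.coeFn_toLp (p := 1) (𝕜 := ℂ) haarC g] with t ht
  rw [ht]

/-! Direction A to S -/
lemma fejer_bound_A (Tz : ℤ → H →L[ℂ] H) (A : ellTwo H →L[ℂ] ellTwo H)
    (hA : Represents (fun k j => Tz ((j : ℤ) - (k : ℤ))) A) (n : ℕ) (t : Circ) :
    ‖fejer Tz n t‖ ≤ ‖A‖ := by
  refine ContinuousLinearMap.opNorm_le_bound _ (norm_nonneg _) fun x => ?_
  rcases Nat.eq_zero_or_pos n with rfl | hn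
  · simp [fejer]; positivity
  have hn' : (0 : ℝ) < n := by exact_mod_cast hn
  set X : ellTwo H := ∑ a ∈ Finset.range n, lp.single 2 a ((fourier (-(a : ℤ)) t : ℂ) • x) with hX
  have hf : ∀ (m : ℤ), ‖(fourier m t : ℂ)‖ = 1 := fun m => by
    rw [fourier_apply, Circle.norm_coe]
  have hXn : ‖X‖ ^ 2 = n * ‖x‖ ^ 2 := by
    have := lp.norm_sum_single (E := fun _ : ℕ => H) (p := 2) (by norm_num)
      (fun a : ℕ => (fourier (-(a : ℤ)) t : ℂ) • x) (Finset.range n)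
    simp only [norm_smul, hf, one_mul, ENNReal.toReal_ofNat, Real.rpow_ofNat, Finset.sum_const,
      Finset.card_range, nsmul_eq_mul] at this
    exact this
  have hAX : ∀ k : ℕ, (A X) k = ∑ a ∈ Finset.range n,
      (fourier (-(a : ℤ)) t : ℂ) • Tz ((a : ℤ) - k) x := by
    intro k
    rw [hX, map_sum, lp.coeFn_sum, Finset.sum_apply]
    refine Finset.sum_congr rfl fun a _ => ?_
    rw [hA a _ k, map_smul]
  have hP : fejer Tz n t x = (n : ℂ)⁻¹ • ∑ b ∈ Finset.range n, (fourier (b : ℤ) t : ℂ) • (A X) b := by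
    simp only [fejer, _root_.smul_apply, _root_.sum_apply, hAX]
    congr 1
    rw [Finset.sum_comm]
    refine Finset.sum_congr rfl fun b _ => ?_
    rw [Finset.smul_sum]
    refine Finset.sum_congr rfl fun a _ => ?_
    rw [smul_smul, ← fourier_add]
    congr 3
    ring
  have h1 : ‖fejer Tz n t x‖ ≤ (n : ℝ)⁻¹ * ∑ b ∈ Finset.range n, ‖(A X) b‖ := by
    rw [hP, norm_smul, norm_inv, Complex.norm_natCast]
    gcongr
    refine (norm_sum_le _ _).trans (Finset.sum_le_sum fun b _ => ?_)
    rw [norm_smul, hf, one_mul]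
  have h2 : (∑ b ∈ Finset.range n, ‖(A X) b‖) ^ 2 ≤ n * ‖A X‖ ^ 2 := by
    have h3 := sq_sum_le_card_mul_sum_sq (s := Finset.range n) (f := fun b => ‖(A X) b‖)
    rw [Finset.card_range] at h3
    refine h3.trans ?_
    gcongr
    have := lp.sum_rpow_le_norm_rpow (p := 2) (by norm_num) (A X) (Finset.range n)
    simpa using this
  have h4 : ‖A X‖ ^ 2 ≤ ‖A‖ ^ 2 * (n * ‖x‖ ^ 2) := by
    rw [← hXn, ← mul_pow]
    gcongr
    exact A.le_opNorm X
  have h5 : ∑ b ∈ Finset.range n, ‖(A X) b‖ ≤ n * (‖A‖ * ‖x‖) := by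
    refine le_of_sq_le_sq ?_ (by positivity)
    calc _ ≤ _ := h2
      _ ≤ n * (‖A‖ ^ 2 * (n * ‖x‖ ^ 2)) := by gcongr
      _ = _ := by ring
  calc _ ≤ _ := h1
    _ ≤ (n : ℝ)⁻¹ * (n * (‖A‖ * ‖x‖)) := by gcongr
    _ = _ := by field_simp

lemma denseRange_fourier : DenseRange (Finsupp.linearCombination ℂ
    (fun l : ℤ => (fourierLp 1 l : L1Circle))) := by
  have h := span_fourierLp_closure_eq_top (T := 2 * Real.pi) (p := 1) (by simp)
  have h2 : Dense ((Submodule.span ℂ (Set.range (fun l : ℤ => (fourierLp 1 l : L1Circle))) :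
    Submodule ℂ L1Circle) : Set L1Circle) := Submodule.dense_iff_topologicalClosure_eq_top.2 h
  rw [← Finsupp.range_linearCombination] at h2
  exact h2

lemma bound_of_A (Tz : ℤ → H →L[ℂ] H) (A : ellTwo H →L[ℂ] ellTwo H)
    (hA : Represents (fun k j => Tz ((j : ℤ) - (k : ℤ))) A) (c : ℤ →₀ ℂ) :
    ‖Finsupp.linearCombination ℂ Tz c‖ ≤ ‖A‖ * ‖Finsupp.linearCombination ℂ
      (fun l : ℤ => (fourierLp 1 l : L1Circle)) c‖ := by
  set g : C(Circ, ℂ) := ∑ l ∈ c.support, c l • fourier l with hg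
  have h0 : Finsupp.linearCombination ℂ (fun l : ℤ => (fourierLp 1 l : L1Circle)) c
      = ContinuousMap.toLp (E := ℂ) 1 haarAddCircle ℂ g := by
    rw [Finsupp.linearCombination_apply, Finsupp.sum, hg, map_sum]
    simp only [map_smul]
  rw [h0, norm_toLp_eq]
  have h1 : ∀ n, ∫ t, g t • fejer Tz n t ∂haarC = ∑ l ∈ c.support, c l • wt n l • Tz l := by
    intro n
    have : ∀ t, g t • fejer Tz n t = ∑ l ∈ c.support, c l • ((fourier l t : ℂ) • fejer Tz n t) := by
      intro t
      rw [hg, ContinuousMap.coe_sum, Finset.sum_apply, Finset.sum_smul]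
      refine Finset.sum_congr rfl fun l _ => ?_
      rw [ContinuousMap.smul_apply, smul_assoc]
    simp_rw [this]
    rw [integral_finsetSum]
    · refine Finset.sum_congr rfl fun l _ => ?_
      rw [integral_smul, integral_fejer]
    · intro l _
      exact integrable_cont (((map_continuous (fourier l)).smul (fejer_continuous Tz n)).const_smul (c l))
  have h2 : ∀ n, ‖∑ l ∈ c.support, c l • wt n l • Tz l‖ ≤ ‖A‖ * ∫ t, ‖g t‖ ∂haarC := by
    intro n
    rw [← h1, ← integral_const_mul]
    refine norm_integral_le_of_norm_le
      ((integrable_cont (map_continuous g).norm).const_mul _) (ae_of_all _ fun t => ?_)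
    rw [norm_smul, mul_comm]
    gcongr
    exact fejer_bound_A Tz A hA n t
  have h3 : Filter.Tendsto (fun n => ∑ l ∈ c.support, c l • wt n l • Tz l) Filter.atTop
      (nhds (∑ l ∈ c.support, c l • (1 : ℂ) • Tz l)) :=
    tendsto_finsetSum _ fun l _ => ((wt_tendsto l).smul_const _).const_smul _
  have := le_of_tendsto h3.norm (Filter.Eventually.of_forall h2)
  simpa [Finsupp.linearCombination_apply, Finsupp.sum] using this

lemma exists_S (Tz : ℤ → H →L[ℂ] H) (A : ellTwo H →L[ℂ] ellTwo H)
    (hA : Represents (fun k j => Tz ((j : ℤ) - (k : ℤ))) A) :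
    ∃ S : L1Circle →L[ℂ] (H →L[ℂ] H), (∀ l : ℤ, S (fourierLp 1 l) = Tz l) ∧ ‖S‖ ≤ ‖A‖ := by
  refine ⟨(Finsupp.linearCombination ℂ Tz).extendOfNorm (Finsupp.linearCombination ℂ
      (fun l : ℤ => (fourierLp 1 l : L1Circle))), fun l => ?_, ?_⟩
  · have := LinearMap.extendOfNorm_eq (f := Finsupp.linearCombination ℂ Tz)
      denseRange_fourier ⟨‖A‖, bound_of_A Tz A hA⟩ (Finsupp.single l 1)
    simpa using this
  · exact LinearMap.opNorm_extendOfNorm_le denseRange_fourier (norm_nonneg _) (bound_of_A Tz A hA)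

lemma S_unique (S S' : L1Circle →L[ℂ] (H →L[ℂ] H))
    (h : ∀ l : ℤ, S (fourierLp 1 l) = S' (fourierLp 1 l)) : S = S' := by
  apply DFunLike.coe_injective
  refine denseRange_fourier.equalizer S.continuous S'.continuous ?_
  funext c
  simp [Finsupp.linearCombination_apply, Finsupp.sum, map_sum, h]

/-! Direction S to A -/
lemma fejer_L1_norm (n : ℕ) (t : Circ) :
    ‖fejer (fun l : ℤ => (fourierLp 1 l : L1Circle)) n t‖ ≤ 1 := by
  rcases Nat.eq_zero_or_pos n with rfl | hn
  · simp [fejer]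
  have hn' : (n : ℂ) ≠ 0 := by exact_mod_cast hn.ne'
  set g : C(Circ, ℂ) := (n : ℂ)⁻¹ • ∑ a ∈ Finset.range n, ∑ b ∈ Finset.range n,
    (fourier (-((a : ℤ) - b)) t : ℂ) • fourier ((a : ℤ) - b) with hg
  have h0 : fejer (fun l : ℤ => (fourierLp 1 l : L1Circle)) n t
      = ContinuousMap.toLp (E := ℂ) 1 haarAddCircle ℂ g := by
    rw [hg, fejer]
    simp only [map_smul, map_sum]
  have hgs : ∀ s, g s = (n : ℂ)⁻¹ * ∑ a ∈ Finset.range n, ∑ b ∈ Finset.range n,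
      (fourier (-((a : ℤ) - b)) t : ℂ) * fourier ((a : ℤ) - b) s := by
    intro s
    simp only [hg, ContinuousMap.smul_apply, ContinuousMap.coe_sum, Finset.sum_apply, smul_eq_mul]
  have hgz : ∀ s, ∃ z : ℂ, g s = (n : ℂ)⁻¹ * (z * (starRingEnd ℂ) z) := by
    intro s
    refine ⟨∑ a ∈ Finset.range n, (fourier (-(a : ℤ)) t : ℂ) * fourier (a : ℤ) s, ?_⟩
    rw [hgs, map_sum, Finset.sum_mul_sum]
    congr 1
    refine Finset.sum_congr rfl fun a _ => Finset.sum_congr rfl fun b _ => ?_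
    rw [map_mul, ← fourier_neg, ← fourier_neg, mul_mul_mul_comm, ← fourier_add, ← fourier_add]
    congr 3; ring
  have hgn : ∀ s, ((‖g s‖ : ℝ) : ℂ) = g s := by
    intro s
    obtain ⟨z, hz⟩ := hgz s
    rw [hz, Complex.mul_conj, norm_mul, norm_inv, Complex.norm_natCast, Complex.norm_real,
      Real.norm_of_nonneg (Complex.normSq_nonneg z)]
    push_cast; ring
  have hint : ∫ s, g s ∂haarC = 1 := by
    simp_rw [hgs]
    have hi : ∀ a b : ℕ, Integrable (fun s : Circ =>
        (fourier (-((a : ℤ) - b)) t : ℂ) * fourier ((a : ℤ) - b) s) haarC := fun a b =>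
      integrable_cont (continuous_const.mul (map_continuous (fourier _)))
    rw [integral_const_mul, integral_finsetSum _
      (fun a _ => integrable_finsetSum _ fun b _ => hi a b)]
    have : ∀ a ∈ Finset.range n, ∫ s : Circ, ∑ b ∈ Finset.range n,
        (fourier (-((a : ℤ) - b)) t : ℂ) * fourier ((a : ℤ) - b) s ∂haarC = 1 := by
      intro a ha
      rw [integral_finsetSum _ (fun b _ => hi a b), Finset.sum_eq_single a]
      · simp
      · intro b _ hb
        rw [integral_const_mul, integral_fourier_eq, if_neg (by omega), mul_zero]
      · intro h; exact absurd ha h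
    rw [Finset.sum_congr rfl this]
    simp [hn']
  have h1 : ((∫ s, ‖g s‖ ∂haarC : ℝ) : ℂ) = 1 := by
    rw [← hint, ← integral_complex_ofReal]
    exact integral_congr_ae (ae_of_all _ hgn)
  rw [h0, norm_toLp_eq]
  exact le_of_eq (by exact_mod_cast h1)

lemma fejer_bound_S (Tz : ℤ → H →L[ℂ] H) (S : L1Circle →L[ℂ] (H →L[ℂ] H))
    (hS : ∀ l : ℤ, S (fourierLp 1 l) = Tz l) (n : ℕ) (t : Circ) :
    ‖fejer Tz n t‖ ≤ ‖S‖ := by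
  have : fejer Tz n t = S (fejer (fun l : ℤ => (fourierLp 1 l : L1Circle)) n t) := by
    simp only [fejer, map_smul, map_sum, hS]
  rw [this]
  exact (S.le_opNorm _).trans (mul_le_of_le_one_right (norm_nonneg _) (fejer_L1_norm n t))

/-- vector trigonometric polynomial -/
def trig (s : Finset ℕ) (x : ℕ → H) (t : Circ) : H := ∑ j ∈ s, (fourier (j : ℤ) t : ℂ) • x j

lemma trig_continuous (s : Finset ℕ) (x : ℕ → H) : Continuous (trig s x) := by
  unfold trig
  refine continuous_finsetSum _ fun j _ => ?_
  exact (map_continuous (fourier _)).smul continuous_const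

lemma inner_expand (s s' : Finset ℕ) (x y : ℕ → H) (B : H →L[ℂ] H) (t : Circ) :
    ⟪trig s' y t, B (trig s x t)⟫_ℂ =
      ∑ j ∈ s, ∑ k ∈ s', (fourier ((j : ℤ) - k) t : ℂ) * ⟪y k, B (x j)⟫_ℂ := by
  simp only [trig, map_sum, map_smul, sum_inner, inner_sum, inner_smul_left, inner_smul_right,
    Finset.mul_sum]
  refine Finset.sum_congr rfl fun j _ => Finset.sum_congr rfl fun k _ => ?_
  rw [← fourier_neg, ← mul_assoc, ← fourier_add]
  congr 3

lemma integral_trig_sq (s : Finset ℕ) (x : ℕ → H) :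
    ∫ t, ‖trig s x t‖ ^ 2 ∂haarC = ∑ j ∈ s, ‖x j‖ ^ 2 := by
  have h : ((∫ t, ‖trig s x t‖ ^ 2 ∂haarC : ℝ) : ℂ) = ((∑ j ∈ s, ‖x j‖ ^ 2 : ℝ) : ℂ) := by
    rw [← integral_complex_ofReal]
    have h1 : ∀ t, (((‖trig s x t‖ ^ 2 : ℝ)) : ℂ) =
        ∑ j ∈ s, ∑ k ∈ s, (fourier ((j : ℤ) - k) t : ℂ) * ⟪x k, x j⟫_ℂ := by
      intro t
      have := inner_expand s s x x (ContinuousLinearMap.id ℂ H) t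
      simp only [ContinuousLinearMap.id_apply] at this
      rw [← this, inner_self_eq_norm_sq_to_K]
      push_cast; rfl
    have hi : ∀ j k : ℕ, Integrable (fun t : Circ =>
        (fourier ((j : ℤ) - k) t : ℂ) * ⟪x k, x j⟫_ℂ) haarC := fun j k =>
      integrable_cont ((map_continuous (fourier _)).mul continuous_const)
    refine (integral_congr_ae (ae_of_all _ h1)).trans ?_
    rw [integral_finsetSum _ (fun j _ => integrable_finsetSum _ fun k _ => hi j k)]
    rw [Complex.ofReal_sum]
    refine Finset.sum_congr rfl fun j hj => ?_
    rw [integral_finsetSum _ (fun k _ => hi j k), Finset.sum_eq_single j]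
    · rw [integral_mul_const, integral_fourier_eq, if_pos (by omega), one_mul,
        inner_self_eq_norm_sq_to_K]
      push_cast; rfl
    · intro k _ hk
      rw [integral_mul_const, integral_fourier_eq, if_neg (by omega), zero_mul]
    · intro h; exact absurd hj h
  exact_mod_cast h

lemma form_bound (Tz : ℤ → H →L[ℂ] H) (S : L1Circle →L[ℂ] (H →L[ℂ] H))
    (hS : ∀ l : ℤ, S (fourierLp 1 l) = Tz l) (s s' : Finset ℕ) (x y : ℕ → H) :
    ‖∑ j ∈ s, ∑ k ∈ s', ⟪y k, Tz ((j : ℤ) - k) (x j)⟫_ℂ‖ ≤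
      ‖S‖ * ((∑ j ∈ s, ‖x j‖ ^ 2 + ∑ k ∈ s', ‖y k‖ ^ 2) / 2) := by
  have key : ∀ n, ∫ t, ⟪trig s' y t, fejer Tz n t (trig s x t)⟫_ℂ ∂haarC =
      ∑ j ∈ s, ∑ k ∈ s', wt n ((j : ℤ) - k) * ⟪y k, Tz ((j : ℤ) - k) (x j)⟫_ℂ := by
    intro n
    have hc : ∀ j k : ℕ, Continuous (fun t : Circ =>
        (fourier ((j : ℤ) - k) t : ℂ) • fejer Tz n t) := fun j k =>
      (map_continuous (fourier _)).smul (fejer_continuous Tz n)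
    have hi : ∀ j k : ℕ, Integrable (fun t : Circ =>
        (fourier ((j : ℤ) - k) t : ℂ) * ⟪y k, fejer Tz n t (x j)⟫_ℂ) haarC := fun j k =>
      integrable_cont ((map_continuous (fourier _)).mul
        (continuous_const.inner ((fejer_continuous Tz n).clm_apply continuous_const)))
    refine (integral_congr_ae (ae_of_all _ fun t => inner_expand s s' x y (fejer Tz n t) t)).trans ?_
    rw [integral_finsetSum _ (fun j _ => integrable_finsetSum _ fun k _ => hi j k)]
    refine Finset.sum_congr rfl fun j _ => ?_
    rw [integral_finsetSum _ (fun k _ => hi j k)]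
    refine Finset.sum_congr rfl fun k _ => ?_
    let L : (H →L[ℂ] H) →L[ℂ] ℂ := (innerSL ℂ (y k)).comp (ContinuousLinearMap.apply ℂ H (x j))
    have h1 := L.integral_comp_comm (integrable_cont (hc j k))
    rw [integral_fejer] at h1
    simpa [L, -fourier_apply] using h1
  have hb : ∀ n, ‖∑ j ∈ s, ∑ k ∈ s', wt n ((j : ℤ) - k) * ⟪y k, Tz ((j : ℤ) - k) (x j)⟫_ℂ‖ ≤
      ‖S‖ * ((∑ j ∈ s, ‖x j‖ ^ 2 + ∑ k ∈ s', ‖y k‖ ^ 2) / 2) := by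
    intro n
    have ix : Integrable (fun t => ‖trig s x t‖ ^ 2) haarC :=
      integrable_cont ((trig_continuous s x).norm.pow 2)
    have iy : Integrable (fun t => ‖trig s' y t‖ ^ 2) haarC :=
      integrable_cont ((trig_continuous s' y).norm.pow 2)
    rw [← key, ← integral_trig_sq, ← integral_trig_sq, ← integral_add ix iy, ← integral_div,
      ← integral_const_mul]
    refine norm_integral_le_of_norm_le (((ix.add iy).div_const 2).const_mul _)
      (ae_of_all _ fun t => ?_)
    calc _ ≤ ‖trig s' y t‖ * ‖fejer Tz n t (trig s x t)‖ := norm_inner_le_norm _ _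
      _ ≤ ‖trig s' y t‖ * (‖S‖ * ‖trig s x t‖) := by
        gcongr
        exact (fejer Tz n t).le_of_opNorm_le (fejer_bound_S Tz S hS n t) _
      _ = ‖S‖ * (‖trig s x t‖ * ‖trig s' y t‖) := by ring
      _ ≤ _ := by
        refine mul_le_mul_of_nonneg_left ?_ (norm_nonneg S)
        nlinarith [sq_nonneg (‖trig s x t‖ - ‖trig s' y t‖)]
  have h3 : Filter.Tendsto (fun n => ∑ j ∈ s, ∑ k ∈ s',
      wt n ((j : ℤ) - k) * ⟪y k, Tz ((j : ℤ) - k) (x j)⟫_ℂ) Filter.atTop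
      (nhds (∑ j ∈ s, ∑ k ∈ s', 1 * ⟪y k, Tz ((j : ℤ) - k) (x j)⟫_ℂ)) :=
    tendsto_finsetSum _ fun j _ => tendsto_finsetSum _ fun k _ => (wt_tendsto _).mul_const _
  have := le_of_tendsto h3.norm (Filter.Eventually.of_forall hb)
  simpa using this

lemma sum_bound (Tz : ℤ → H →L[ℂ] H) (S : L1Circle →L[ℂ] (H →L[ℂ] H))
    (hS : ∀ l : ℤ, S (fourierLp 1 l) = Tz l) (s s' : Finset ℕ) (x : ℕ → H) :
    ∑ k ∈ s', ‖∑ j ∈ s, Tz ((j : ℤ) - k) (x j)‖ ^ 2 ≤ ‖S‖ ^ 2 * ∑ j ∈ s, ‖x j‖ ^ 2 := by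
  set z : ℕ → H := fun k => ∑ j ∈ s, Tz ((j : ℤ) - k) (x j) with hz
  have hform : ∀ r : ℝ, ‖∑ j ∈ s, ∑ k ∈ s', ⟪(r : ℂ) • z k, Tz ((j : ℤ) - k) (x j)⟫_ℂ‖ =
      |r| * ∑ k ∈ s', ‖z k‖ ^ 2 := by
    intro r
    rw [Finset.sum_comm]
    have : ∀ k ∈ s', ∑ j ∈ s, ⟪(r : ℂ) • z k, Tz ((j : ℤ) - k) (x j)⟫_ℂ =
        (r : ℂ) * ((‖z k‖ ^ 2 : ℝ) : ℂ) := by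
      intro k _
      rw [← inner_sum, inner_smul_left, Complex.conj_ofReal]
      congr 1
      change ⟪z k, z k⟫_ℂ = _
      rw [inner_self_eq_norm_sq_to_K]
      push_cast; rfl
    rw [Finset.sum_congr rfl this, ← Finset.mul_sum, ← Complex.ofReal_sum, norm_mul,
      Complex.norm_real, Complex.norm_real, Real.norm_eq_abs, Real.norm_of_nonneg]
    positivity
  have hb : ∀ r : ℝ, |r| * ∑ k ∈ s', ‖z k‖ ^ 2 ≤
      ‖S‖ * ((∑ j ∈ s, ‖x j‖ ^ 2 + r ^ 2 * ∑ k ∈ s', ‖z k‖ ^ 2) / 2) := by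
    intro r
    have := form_bound Tz S hS s s' x (fun k => (r : ℂ) • z k)
    rw [hform] at this
    simpa only [norm_smul, mul_pow, Complex.norm_real, Real.norm_eq_abs, sq_abs,
      ← Finset.mul_sum] using this
  rcases (norm_nonneg S).eq_or_lt with h0 | h0
  · have := hb 1
    rw [← h0] at this ⊢
    simpa using this
  · have := hb (‖S‖⁻¹)
    rw [abs_of_pos (inv_pos.2 h0)] at this
    set Z := ∑ k ∈ s', ‖z k‖ ^ 2
    have h5 := mul_le_mul_of_nonneg_left this h0.le
    have e1 : ‖S‖ * (‖S‖⁻¹ * Z) = Z := by field_simp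
    have e2 : ‖S‖ * (‖S‖ * ((∑ j ∈ s, ‖x j‖ ^ 2 + ‖S‖⁻¹ ^ 2 * Z) / 2)) =
      (‖S‖ ^ 2 * (∑ j ∈ s, ‖x j‖ ^ 2) + Z) / 2 := by field_simp
    rw [e1, e2] at h5
    linarith

/-- columns -/
def col (Tz : ℤ → H →L[ℂ] H) (S : L1Circle →L[ℂ] (H →L[ℂ] H))
    (hS : ∀ l : ℤ, S (fourierLp 1 l) = Tz l) (j : ℕ) : H →ₗ[ℂ] ellTwo H where
  toFun x := ⟨fun k => Tz ((j : ℤ) - k) x, memℓp_gen' (C := ‖S‖ ^ 2 * ‖x‖ ^ 2) fun s => by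
    have := sum_bound Tz S hS {j} s (fun _ => x)
    simpa using this⟩
  map_add' x y := by ext k; simp; rfl
  map_smul' c x := by ext k; simp

def emb : (ℕ →₀ H) →ₗ[ℂ] ellTwo H :=
  Finsupp.lsum ℂ (fun j => lp.lsingle (𝕜 := ℂ) (E := fun _ : ℕ => H) 2 j)

lemma emb_dense : DenseRange (emb (H := H)) := by
  intro f
  have h := lp.hasSum_single (E := fun _ : ℕ => H) (p := 2) (by simp) f
  refine mem_closure_of_tendsto h (Filter.Eventually.of_forall fun s => ?_)
  refine ⟨∑ j ∈ s, Finsupp.single j (f j), ?_⟩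
  rw [map_sum]
  refine Finset.sum_congr rfl fun j _ => ?_
  simp [emb]

lemma col_bound (Tz : ℤ → H →L[ℂ] H) (S : L1Circle →L[ℂ] (H →L[ℂ] H))
    (hS : ∀ l : ℤ, S (fourierLp 1 l) = Tz l) (x : ℕ →₀ H) :
    ‖Finsupp.lsum ℂ (col Tz S hS) x‖ ≤ ‖S‖ * ‖emb x‖ := by
  have hx : ‖emb x‖ ^ 2 = ∑ j ∈ x.support, ‖x j‖ ^ 2 := by
    have := lp.norm_sum_single (E := fun _ : ℕ => H) (p := 2) (by norm_num) x x.support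
    simp only [ENNReal.toReal_ofNat, Real.rpow_ofNat] at this
    rw [← this, emb, Finsupp.lsum_apply, Finsupp.sum]
    rfl
  refine lp.norm_le_of_forall_sum_le (by norm_num) (by positivity) fun s => ?_
  have := sum_bound Tz S hS x.support s x
  rw [← hx, ← mul_pow] at this
  simp only [ENNReal.toReal_ofNat, Real.rpow_ofNat]
  convert this using 4 with k
  rw [Finsupp.lsum_apply, Finsupp.sum, lp.coeFn_sum, Finset.sum_apply]
  rfl

lemma exists_A (Tz : ℤ → H →L[ℂ] H) (S : L1Circle →L[ℂ] (H →L[ℂ] H))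
    (hS : ∀ l : ℤ, S (fourierLp 1 l) = Tz l) :
    ∃ A : ellTwo H →L[ℂ] ellTwo H,
      Represents (fun k j => Tz ((j : ℤ) - (k : ℤ))) A ∧ ‖A‖ ≤ ‖S‖ := by
  refine ⟨(Finsupp.lsum ℂ (col Tz S hS)).extendOfNorm emb, fun j x k => ?_, ?_⟩
  · have := LinearMap.extendOfNorm_eq (f := Finsupp.lsum ℂ (col Tz S hS))
      emb_dense ⟨‖S‖, col_bound Tz S hS⟩ (Finsupp.single j x)
    have e : emb (Finsupp.single j x) = (lp.single 2 j x : ellTwo H) := by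
      simp [emb]
    rw [e] at this
    rw [this, Finsupp.lsum_single]
    rfl
  · exact LinearMap.opNorm_extendOfNorm_le (f := Finsupp.lsum ℂ (col Tz S hS)) emb_dense
      (norm_nonneg S) (col_bound Tz S hS)

lemma A_unique (T : ℕ → ℕ → H →L[ℂ] H) (A A' : ellTwo H →L[ℂ] ellTwo H)
    (h : Represents T A) (h' : Represents T A') : A = A' := by
  apply DFunLike.coe_injective
  refine emb_dense.equalizer A.continuous A'.continuous ?_
  funext c
  have e : emb c = ∑ j ∈ c.support, (lp.single 2 j (c j) : ellTwo H) := by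
    rw [emb, Finsupp.lsum_apply, Finsupp.sum]; rfl
  simp only [Function.comp, e, map_sum]
  refine Finset.sum_congr rfl fun j _ => ?_
  ext k
  rw [h, h']

theorem toeplitz_bounded_iff_L1_operator (Tz : ℤ → H →L[ℂ] H) :
    ((∃ A : ellTwo H →L[ℂ] ellTwo H,
        Represents (fun k j => Tz ((j : ℤ) - (k : ℤ))) A) ↔
      ∃ S : L1Circle →L[ℂ] (H →L[ℂ] H), ∀ l : ℤ, S (fourierLp 1 l) = Tz l) ∧
    ∀ (A : ellTwo H →L[ℂ] ellTwo H) (S : L1Circle →L[ℂ] (H →L[ℂ] H)),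
      Represents (fun k j => Tz ((j : ℤ) - (k : ℤ))) A →
      (∀ l : ℤ, S (fourierLp 1 l) = Tz l) → ‖A‖ = ‖S‖ := by
  refine ⟨⟨?_, ?_⟩, ?_⟩
  · rintro ⟨A, hA⟩
    obtain ⟨S, hS, _⟩ := exists_S Tz A hA
    exact ⟨S, hS⟩
  · rintro ⟨S, hS⟩
    obtain ⟨A, hA, _⟩ := exists_A Tz S hS
    exact ⟨A, hA⟩
  · intro A S hA hS
    obtain ⟨S', hS', h1⟩ := exists_S Tz A hA
    obtain ⟨A', hA', h2⟩ := exists_A Tz S hS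
    rw [A_unique _ A' A hA' hA] at h2
    rw [S_unique S' S (fun l => by rw [hS, hS'])] at h1
    exact le_antisymm h2 h1

end
end

section
/- Let H be a complex separable Hilbert space, let A=(T_{kj})_{k,j≥1} be a matrix with entries in B(H), and let x₀, y₀ ∈ H with ‖x₀‖ = ‖y₀‖ = 1. Define the scalar matrix A_{x₀,y₀} = (γ_{kj})_{k,j≥1} by γ_{kj} = ⟨T_{kj}(x₀), y₀⟩. If A is a right Schur multiplier on ℓ²(H), then A_{x₀,y₀} is a Schur multiplier of B(ℓ²) with multiplier norm at most ‖A‖_{M_r}; if A is a left Schur multiplier on ℓ²(H), then A_{x₀,y₀} is a Schur multiplier of B(ℓ²) with multiplier norm at most ‖A‖_{M_l}. -/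
open scoped ENNReal NNReal InnerProductSpace
open MeasureTheory Complex

noncomputable section

variable {H : Type*} [NormedAddCommGroup H] [InnerProductSpace ℂ H] [CompleteSpace H]

/-- A bounded operator on `ℓ² = ℓ²(ℂ)` represents a scalar matrix `(γ k j)`. -/
def RepresentsC (γ : ℕ → ℕ → ℂ) (A : ellTwo ℂ →L[ℂ] ellTwo ℂ) : Prop :=
  ∀ (j : ℕ) (a : ℂ) (k : ℕ), A (lp.single 2 j a) k = γ k j * a

/-- Entrywise lift of a contraction to `ℓ²`. -/
def liftL {E F : Type*} [NormedAddCommGroup E] [InnerProductSpace ℂ E] [NormedAddCommGroup F]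
    [InnerProductSpace ℂ F] (L : E →L[ℂ] F) (hL : ‖L‖ ≤ 1) : ellTwo E →L[ℂ] ellTwo F :=
  have hb : ∀ x : E, ‖L x‖ ≤ ‖x‖ := fun x => by
    simpa using L.le_of_opNorm_le hL x
  have hm : ∀ x : ellTwo E, Memℓp (fun j => L (x j)) 2 := fun x =>
    memℓp_gen (((lp.memℓp x).summable (by norm_num)).of_nonneg_of_le
      (fun i => by positivity)
      (fun i => Real.rpow_le_rpow (norm_nonneg _) (hb _) (by norm_num)))
  LinearMap.mkContinuous
    { toFun := fun x => ⟨fun j => L (x j), hm x⟩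
      map_add' := fun x y => by ext j; exact L.map_add (x j) (y j)
      map_smul' := fun c x => by ext j; simp } 1 (fun x => by
        rw [one_mul]
        refine lp.norm_le_of_tsum_le (by norm_num) (norm_nonneg _) ?_
        rw [lp.norm_rpow_eq_tsum (by norm_num) x]
        exact Summable.tsum_le_tsum
          (fun i => Real.rpow_le_rpow (norm_nonneg _) (hb _) (by norm_num))
          ((hm x).summable (by norm_num)) ((lp.memℓp x).summable (by norm_num)))

section
variable {E F : Type*} [NormedAddCommGroup E] [InnerProductSpace ℂ E] [NormedAddCommGroup F]
    [InnerProductSpace ℂ F]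

theorem liftL_apply (L : E →L[ℂ] F) (hL : ‖L‖ ≤ 1) (x : ellTwo E) (j : ℕ) :
    liftL L hL x j = L (x j) := rfl

theorem liftL_norm (L : E →L[ℂ] F) (hL : ‖L‖ ≤ 1) : ‖liftL L hL‖ ≤ 1 := by
  unfold liftL
  exact LinearMap.mkContinuous_norm_le _ zero_le_one _

theorem liftL_single (L : E →L[ℂ] F) (hL : ‖L‖ ≤ 1) (j : ℕ) (x : E) :
    liftL L hL (lp.single 2 j x) = lp.single 2 j (L x) := by
  ext k
  rw [liftL_apply]
  by_cases h : k = j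
  · subst h; simp
  · simp [h]

theorem norm_sandwich {X Y Z W : Type*} [NormedAddCommGroup X] [NormedSpace ℂ X]
    [NormedAddCommGroup Y] [NormedSpace ℂ Y] [NormedAddCommGroup Z] [NormedSpace ℂ Z]
    [NormedAddCommGroup W] [NormedSpace ℂ W]
    (P : Z →L[ℂ] W) (Q : Y →L[ℂ] Z) (R : X →L[ℂ] Y) (hP : ‖P‖ ≤ 1) (hR : ‖R‖ ≤ 1) :
    ‖P.comp (Q.comp R)‖ ≤ ‖Q‖ := by
  calc ‖P.comp (Q.comp R)‖ ≤ ‖P‖ * (‖Q‖ * ‖R‖) :=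
        (P.opNorm_comp_le _).trans (by gcongr; exact Q.opNorm_comp_le R)
    _ ≤ 1 * (‖Q‖ * 1) := by gcongr
    _ = ‖Q‖ := by ring
end

theorem norm_V {u : H} (hu : ‖u‖ = 1) : ‖ContinuousLinearMap.toSpanSingleton ℂ u‖ ≤ 1 := by
  simp [hu]

theorem norm_W {u : H} (hu : ‖u‖ = 1) : ‖innerSL ℂ u‖ ≤ 1 := by
  simp [hu]

/-- Ampliation of a scalar operator along a unit vector. -/
theorem exists_ampl {u : H} (hu : ‖u‖ = 1) (β : ℕ → ℕ → ℂ) (B : ellTwo ℂ →L[ℂ] ellTwo ℂ)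
    (hB : RepresentsC β B) :
    ∃ B' : ellTwo H →L[ℂ] ellTwo H,
      Represents (fun k j => β k j • (ContinuousLinearMap.toSpanSingleton ℂ u).comp (innerSL ℂ u))
        B' ∧ ‖B'‖ = ‖B‖ := by
  refine ⟨(liftL _ (norm_V hu)).comp (B.comp (liftL _ (norm_W hu))), ?_, le_antisymm ?_ ?_⟩
  · intro j x k
    rw [ContinuousLinearMap.comp_apply, ContinuousLinearMap.comp_apply, liftL_single, liftL_apply,
      hB]
    simp [smul_smul]
  · exact norm_sandwich _ _ _ (liftL_norm _ _) (liftL_norm _ _)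
  · have hWV : ∀ z : ellTwo ℂ, liftL _ (norm_W hu) (liftL _ (norm_V hu) z) = z := by
      intro z
      ext k
      simp [liftL_apply, inner_smul_right, inner_self_eq_norm_sq_to_K, hu]
    have h := norm_sandwich (liftL _ (norm_W hu))
      ((liftL _ (norm_V hu)).comp (B.comp (liftL _ (norm_W hu)))) (liftL _ (norm_V hu))
      (liftL_norm _ _) (liftL_norm _ _)
    refine le_trans (le_of_eq ?_) h
    congr 1
    ext1 z
    simp only [ContinuousLinearMap.comp_apply, hWV]

/-- Compression to scalar operators. -/
theorem exists_compr {u v : H} (hu : ‖u‖ = 1) (hv : ‖v‖ = 1) (R : ℕ → ℕ → H →L[ℂ] H)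
    (D : ellTwo H →L[ℂ] ellTwo H) (hD : Represents R D) :
    ∃ D' : ellTwo ℂ →L[ℂ] ellTwo ℂ,
      RepresentsC (fun k j => ⟪v, R k j u⟫_ℂ) D' ∧ ‖D'‖ ≤ ‖D‖ := by
  refine ⟨(liftL _ (norm_W hv)).comp (D.comp (liftL _ (norm_V hu))), ?_,
    norm_sandwich _ _ _ (liftL_norm _ _) (liftL_norm _ _)⟩
  intro j a k
  rw [ContinuousLinearMap.comp_apply, ContinuousLinearMap.comp_apply, liftL_single, liftL_apply,
    hD]
  simp [inner_smul_right, mul_comm]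

/-- **Scalarization of operator-valued Schur multipliers.**  If `A = (T k j)` is a right
(resp. left) Schur multiplier on `ℓ²(H)` with multiplier constant `C`, and `x₀, y₀` are unit
vectors, then the scalar matrix `γ k j = ⟨T k j x₀, y₀⟩` is a Schur multiplier of `B(ℓ²)` with
multiplier constant `C`. -/
theorem scalar_matrix_of_schur_multiplier
    (T : ℕ → ℕ → H →L[ℂ] H) (x₀ y₀ : H) (hx₀ : ‖x₀‖ = 1) (hy₀ : ‖y₀‖ = 1) (C : ℝ) :
    -- right multiplier case
    ((∀ (S : ℕ → ℕ → H →L[ℂ] H) (B : ellTwo H →L[ℂ] ellTwo H), Represents S B →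
        ∃ D : ellTwo H →L[ℂ] ellTwo H,
          Represents (fun k j => (S k j).comp (T k j)) D ∧ ‖D‖ ≤ C * ‖B‖) →
      ∀ (β : ℕ → ℕ → ℂ) (B : ellTwo ℂ →L[ℂ] ellTwo ℂ), RepresentsC β B →
        ∃ D : ellTwo ℂ →L[ℂ] ellTwo ℂ,
          RepresentsC (fun k j => ⟪y₀, T k j x₀⟫_ℂ * β k j) D ∧ ‖D‖ ≤ C * ‖B‖) ∧
    -- left multiplier case
    ((∀ (S : ℕ → ℕ → H →L[ℂ] H) (B : ellTwo H →L[ℂ] ellTwo H), Represents S B →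
        ∃ D : ellTwo H →L[ℂ] ellTwo H,
          Represents (fun k j => (T k j).comp (S k j)) D ∧ ‖D‖ ≤ C * ‖B‖) →
      ∀ (β : ℕ → ℕ → ℂ) (B : ellTwo ℂ →L[ℂ] ellTwo ℂ), RepresentsC β B →
        ∃ D : ellTwo ℂ →L[ℂ] ellTwo ℂ,
          RepresentsC (fun k j => ⟪y₀, T k j x₀⟫_ℂ * β k j) D ∧ ‖D‖ ≤ C * ‖B‖) := by
  constructor
  · intro h β B hB
    obtain ⟨B', hB', hn⟩ := exists_ampl hy₀ β B hB
    obtain ⟨D, hD, hDn⟩ := h _ B' hB'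
    obtain ⟨D', hD', hDn'⟩ := exists_compr hx₀ hy₀ _ D hD
    refine ⟨D', ?_, by rw [← hn]; exact hDn'.trans hDn⟩
    convert hD' using 3 with k j
    simp [inner_smul_right, inner_self_eq_norm_sq_to_K, hy₀, mul_comm]
  · intro h β B hB
    obtain ⟨B', hB', hn⟩ := exists_ampl hx₀ β B hB
    obtain ⟨D, hD, hDn⟩ := h _ B' hB'
    obtain ⟨D', hD', hDn'⟩ := exists_compr hx₀ hy₀ _ D hD
    refine ⟨D', ?_, by rw [← hn]; exact hDn'.trans hDn⟩
    convert hD' using 3 with k j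
    simp [inner_smul_right, inner_self_eq_norm_sq_to_K, hx₀, mul_comm]

end
end
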